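/- arXiv:1007.5302 — 3 statements merged into one kernel-verified Lean document; each statement's English description precedes it below -/
import Mathlib

section
/- Fix j ∈ {1,…,n} and let f : ℝ^d → ℝ be bounded and continuous. Suppose u : [0,∞)ⁿ × ℝ^d → ℝ is bounded and continuous, is C¹ in t_j and C² in x on (0,∞)ⁿ × ℝ^d, satisfies ∂u/∂t_j (t,x) = (1/2)(∏_{i∈{1,…,n}\{j}} t_i) Δ_x u(t,x) for all t ∈ (0,∞)ⁿ and x ∈ ℝ^d, and satisfies u(t,x) = f(x) whenever t_j = 0. Then u(t,x) = ∫_{ℝ^d} f(y) K^{BS}(t;x,y) dy for all t ∈ (0,∞)ⁿ and x ∈ ℝ^d; in particular, the bounded solution of this initial-value problem is unique. -/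
open MeasureTheory Real Filter Finset

noncomputable section

/-- Partial derivative of `g` in the `k`-th coordinate direction, at `x`. -/
def pd {m : ℕ} {E : Type*} [NormedAddCommGroup E] [NormedSpace ℝ E]
    (k : Fin m) (g : (Fin m → ℝ) → E) (x : Fin m → ℝ) : E :=
  deriv (fun h : ℝ => g (Function.update x k h)) (x k)

/-- The Laplacian of `g : ℝ^m → E`, as the sum of its second coordinate partials. -/
def lap {m : ℕ} {E : Type*} [NormedAddCommGroup E] [NormedSpace ℝ E]
    (g : (Fin m → ℝ) → E) (x : Fin m → ℝ) : E :=
  ∑ k, pd k (pd k g) x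

/-- The `n`-parameter `d`-dimensional Brownian sheet kernel
`K^{BS}(t;x,y) = (2π t₁⋯t_n)^{-d/2} exp(-|x-y|²/(2 t₁⋯t_n))`. -/
def Kbs (n d : ℕ) (t : Fin n → ℝ) (x y : Fin d → ℝ) : ℝ :=
  (2 * π * ∏ i, t i) ^ (-(d : ℝ) / 2) *
    Real.exp (-(∑ k, (x k - y k) ^ 2) / (2 * ∏ i, t i))

/-- The one-dimensional heat (Brownian motion transition) kernel
`K^{BM}(t;0,s) = (2πt)^{-1/2} exp(-s²/(2t))`. -/
def Kbm (t s : ℝ) : ℝ :=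
  (2 * π * t) ^ (-(1 : ℝ) / 2) * Real.exp (-(s ^ 2) / (2 * t))

/-- The `n`-parameter `d`-dimensional complex propagator kernel
`p_{is}(x,y) = (2πi s₁⋯s_n)^{-d/2} exp(-|x-y|²/(2i s₁⋯s_n))` (principal branch). -/
def pProp (n d : ℕ) (s : Fin n → ℝ) (x y : Fin d → ℝ) : ℂ :=
  (2 * (π : ℂ) * Complex.I * ∏ i, (s i : ℂ)) ^ (-(d : ℂ) / 2) *
    Complex.exp (-((∑ k, (x k - y k) ^ 2 : ℝ) : ℂ) /
      (2 * Complex.I * ∏ i, (s i : ℂ)))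

/-- The squared Euclidean distance of `x` and `y`. -/
def sqDist {d : ℕ} (x y : Fin d → ℝ) : ℝ := ∑ k, (x k - y k) ^ 2

/-- The `d`-dimensional heat kernel at time `τ`. -/
def heatKernel (d : ℕ) (τ : ℝ) (x y : Fin d → ℝ) : ℝ :=
  (2 * π * τ) ^ (-(d : ℝ) / 2) * Real.exp (-(sqDist x y) / (2 * τ))

theorem sqDist_nonneg {d : ℕ} (x y : Fin d → ℝ) : 0 ≤ sqDist x y :=
  Finset.sum_nonneg fun _ _ => sq_nonneg _

theorem sq_le_sqDist {d : ℕ} (x y : Fin d → ℝ) (k : Fin d) : (x k - y k) ^ 2 ≤ sqDist x y :=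
  Finset.single_le_sum (f := fun k => (x k - y k) ^ 2) (fun _ _ => sq_nonneg _) (Finset.mem_univ k)

theorem continuous_sqDist {d : ℕ} (x : Fin d → ℝ) : Continuous fun y => sqDist x y := by
  unfold sqDist; fun_prop

theorem sqDist_update {d : ℕ} (x y : Fin d → ℝ) (k : Fin d) (h : ℝ) :
    sqDist (Function.update x k h) y = (h - y k) ^ 2 + (sqDist x y - (x k - y k) ^ 2) := by
  unfold sqDist
  rw [← Finset.add_sum_erase _ _ (Finset.mem_univ k),
    ← Finset.add_sum_erase _ (fun i => (x i - y i) ^ 2) (Finset.mem_univ k),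
    Function.update_self, add_sub_cancel_left]
  congr 1
  refine Finset.sum_congr rfl fun i hi => ?_
  rw [Function.update_of_ne (Finset.ne_of_mem_erase hi)]

theorem integrable_exp_neg_mul_sqDist {d : ℕ} {b : ℝ} (hb : 0 < b) (x : Fin d → ℝ) :
    Integrable fun y : Fin d → ℝ => Real.exp (-b * sqDist x y) := by
  have h := Integrable.fintype_prod (μ := fun _ : Fin d => (volume : Measure ℝ))
    (f := fun k s => Real.exp (-b * (x k - s) ^ 2))
    fun k => (integrable_exp_neg_mul_sq hb).comp_sub_left (x k)
  refine h.congr (Eventually.of_forall fun y => ?_)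
  simp only [sqDist, Finset.mul_sum, Real.exp_sum]

theorem integral_heatKernel_one (d : ℕ) :
    ∫ z : Fin d → ℝ, heatKernel d 1 0 z = 1 := by
  have h : ∀ z : Fin d → ℝ, heatKernel d 1 0 z
      = (2 * π) ^ (-(d : ℝ) / 2) * ∏ k, Real.exp (-(1 / 2) * z k ^ 2) := by
    intro z
    rw [heatKernel, ← Real.exp_sum, ← Finset.mul_sum, sqDist]
    simp only [Pi.zero_apply, zero_sub, neg_sq, mul_one]
    ring_nf
  simp_rw [h]
  rw [integral_const_mul,
    integral_fintype_prod_volume_eq_pow (ι := Fin d) (f := fun s : ℝ => Real.exp (-(1 / 2) * s ^ 2)),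
    integral_gaussian, Fintype.card_fin, Real.sqrt_eq_rpow, ← Real.rpow_natCast, ← Real.rpow_mul (by positivity)]
  rw [show π / (1 / 2) = 2 * π by ring, ← Real.rpow_add (by positivity)]
  ring_nf
  simp

theorem integrable_heatKernel {d : ℕ} {τ : ℝ} (hτ : 0 < τ) (x : Fin d → ℝ) :
    Integrable fun y => heatKernel d τ x y := by
  unfold heatKernel
  refine Integrable.const_mul ((integrable_exp_neg_mul_sqDist (b := 1 / (2 * τ)) (by positivity) x).congr
    (Eventually.of_forall fun y => ?_)) _
  simp only
  ring_nf

theorem continuous_heatKernel {d : ℕ} (τ : ℝ) (x : Fin d → ℝ) :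
    Continuous fun y => heatKernel d τ x y := by
  unfold heatKernel
  have := continuous_sqDist x
  fun_prop

theorem heatKernel_nonneg {d : ℕ} {τ : ℝ} (hτ : 0 < τ) (x y : Fin d → ℝ) :
    0 ≤ heatKernel d τ x y := by
  unfold heatKernel; positivity

theorem hasDerivAt_heatKernel_space {d : ℕ} (τ : ℝ) (x y : Fin d → ℝ) (k : Fin d) (h : ℝ) :
    HasDerivAt (fun h => heatKernel d τ (Function.update x k h) y)
      (-(h - y k) / τ * heatKernel d τ (Function.update x k h) y) h := by
  simp only [heatKernel, sqDist_update]
  have h1 : HasDerivAt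
      (fun h : ℝ => -((h - y k) ^ 2 + (sqDist x y - (x k - y k) ^ 2)) / (2 * τ))
      (-(2 * (h - y k)) / (2 * τ)) h := by
    have := ((((hasDerivAt_id h).sub_const (y k)).pow 2).add_const
      (sqDist x y - (x k - y k) ^ 2)).neg.div_const (2 * τ)
    simpa using this
  refine (h1.exp.const_mul _).congr_deriv ?_
  have h2 : -(2 * (h - y k)) / (2 * τ) = -(h - y k) / τ := by
    rw [← mul_neg, mul_div_mul_left _ _ two_ne_zero]
  rw [h2]
  ring

theorem hasDerivAt_heatKernel_space_two {d : ℕ} (τ : ℝ) (x y : Fin d → ℝ) (k : Fin d) (h : ℝ) :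
    HasDerivAt (fun h => -(h - y k) / τ * heatKernel d τ (Function.update x k h) y)
      (((h - y k) ^ 2 / τ ^ 2 - 1 / τ) * heatKernel d τ (Function.update x k h) y) h := by
  have h1 : HasDerivAt (fun h : ℝ => -(h - y k) / τ) (-1 / τ) h := by
    simpa using ((hasDerivAt_id h).sub_const (y k)).neg.div_const τ
  refine (h1.mul (hasDerivAt_heatKernel_space τ x y k h)).congr_deriv ?_
  simp only [div_eq_mul_inv]
  ring

theorem hasDerivAt_heatKernel_time {d : ℕ} {τ : ℝ} (hτ : 0 < τ) (x y : Fin d → ℝ) :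
    HasDerivAt (fun τ => heatKernel d τ x y)
      ((sqDist x y / (2 * τ ^ 2) - d / (2 * τ)) * heatKernel d τ x y) τ := by
  simp only [heatKernel]
  have h0 : HasDerivAt (fun τ : ℝ => 2 * π * τ) (2 * π) τ := by
    simpa using (hasDerivAt_id τ).const_mul (2 * π)
  have h1 := h0.rpow_const (p := -(d : ℝ) / 2) (Or.inl (by positivity))
  have h2 : HasDerivAt (fun τ : ℝ => -(sqDist x y) / (2 * τ)) (sqDist x y / (2 * τ ^ 2)) τ := by
    have h3 : HasDerivAt (fun τ : ℝ => 2 * τ) 2 τ := by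
      simpa using (hasDerivAt_id τ).const_mul (2 : ℝ)
    refine ((hasDerivAt_const τ (-(sqDist x y))).div h3 (by positivity)).congr_deriv ?_
    field_simp
    ring
  refine (h1.mul h2.exp).congr_deriv ?_
  rw [Real.rpow_sub_one (by positivity)]
  field_simp
  ring

theorem one_add_mul_exp_le {b r : ℝ} (hb : 0 < b) (hr : 0 ≤ r) :
    (1 + r) * Real.exp (-(2 * b) * r) ≤ (1 + 1 / b) * Real.exp (-b * r) := by
  have h1 : Real.exp (-(2 * b) * r) = Real.exp (-b * r) * Real.exp (-b * r) := by
    rw [← Real.exp_add]; ring_nf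
  rw [h1, ← mul_assoc]
  gcongr
  have h2 : b * r ≤ Real.exp (b * r) := by linarith [Real.add_one_le_exp (b * r)]
  have h3 : r ≤ 1 / b * Real.exp (b * r) := by
    rw [one_div, ← div_eq_inv_mul, le_div_iff₀ hb]; linarith
  have h4 : Real.exp (b * r) * Real.exp (-b * r) = 1 := by
    rw [← Real.exp_add]; simp
  have h5 : Real.exp (-b * r) ≤ 1 := Real.exp_le_one_iff.2 (by nlinarith)
  have h6 := mul_le_mul_of_nonneg_right h3 (Real.exp_pos (-b * r)).le
  rw [mul_assoc, h4] at h6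
  linarith

theorem abs_mul_heatKernel_update_le {d : ℕ} {τ : ℝ} (hτ : 0 < τ) (x y : Fin d → ℝ) (k : Fin d)
    {a h A p : ℝ} (hah : |h - a| ≤ 1) (hA : 0 ≤ A)
    (hp : |p| ≤ A * (1 + sqDist (Function.update x k h) y)) :
    |p * heatKernel d τ (Function.update x k h) y| ≤
      A * (2 * π * τ) ^ (-(d : ℝ) / 2) * (1 + 4 * τ) * Real.exp (1 / (4 * τ)) *
        Real.exp (-(1 / (8 * τ)) * sqDist (Function.update x k a) y) := by
  set S := sqDist (Function.update x k h) y with hS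
  have hS0 : 0 ≤ S := sqDist_nonneg _ _
  have hSa : sqDist (Function.update x k a) y ≤ 2 * S + 2 := by
    have h1 := sqDist_update x y k h
    have h2 := sqDist_update x y k a
    have h3 := sq_le_sqDist x y k
    have h4 := abs_le.1 hah
    nlinarith [sq_nonneg ((h - y k) + (h - a))]
  have hb : (0 : ℝ) < 1 / (4 * τ) := by positivity
  have key := one_add_mul_exp_le hb hS0
  rw [abs_mul, abs_of_nonneg (heatKernel_nonneg hτ _ _), heatKernel, ← hS]
  have e1 : -S / (2 * τ) = -(2 * (1 / (4 * τ))) * S := by field_simp; norm_num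
  have e2 : 1 / (1 / (4 * τ)) = 4 * τ := by simp
  rw [e1]
  rw [e2] at key
  have h7 : Real.exp (-(1 / (4 * τ)) * S) ≤ Real.exp (1 / (4 * τ)) *
      Real.exp (-(1 / (8 * τ)) * sqDist (Function.update x k a) y) := by
    rw [← Real.exp_add]
    apply Real.exp_le_exp.2
    have e3 : 1 / (4 * τ) = 2 * (1 / (8 * τ)) := by field_simp; norm_num
    have : (0 : ℝ) < 1 / (8 * τ) := by positivity
    rw [e3]
    nlinarith
  calc |p| * ((2 * π * τ) ^ (-(d : ℝ) / 2) * Real.exp (-(2 * (1 / (4 * τ))) * S))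
      ≤ A * (1 + S) * ((2 * π * τ) ^ (-(d : ℝ) / 2) * Real.exp (-(2 * (1 / (4 * τ))) * S)) := by
        gcongr
    _ = A * (2 * π * τ) ^ (-(d : ℝ) / 2) * ((1 + S) * Real.exp (-(2 * (1 / (4 * τ))) * S)) := by
        ring
    _ ≤ A * (2 * π * τ) ^ (-(d : ℝ) / 2) * ((1 + 4 * τ) * (Real.exp (1 / (4 * τ)) *
      Real.exp (-(1 / (8 * τ)) * sqDist (Function.update x k a) y))) := by
        refine mul_le_mul_of_nonneg_left (key.trans ?_) (by positivity)
        gcongr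
    _ = _ := by ring

theorem abs_heatKernel_time_deriv_le {d : ℕ} {τ₀ τ : ℝ} (hτ₀ : 0 < τ₀) (h1 : τ₀ / 2 < τ)
    (h2 : τ < 2 * τ₀) (x y : Fin d → ℝ) :
    |(sqDist x y / (2 * τ ^ 2) - d / (2 * τ)) * heatKernel d τ x y| ≤
      (2 / τ₀ ^ 2 + d / τ₀) * (π * τ₀) ^ (-(d : ℝ) / 2) * (1 + 8 * τ₀) *
        Real.exp (-(1 / (8 * τ₀)) * sqDist x y) := by
  have hτ : 0 < τ := by linarith
  set S := sqDist x y with hS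
  have hS0 : 0 ≤ S := sqDist_nonneg _ _
  have hb : (0 : ℝ) < 1 / (8 * τ₀) := by positivity
  have key := one_add_mul_exp_le hb hS0
  have e2 : 1 / (1 / (8 * τ₀)) = 8 * τ₀ := by simp
  rw [e2] at key
  rw [abs_mul, abs_of_nonneg (heatKernel_nonneg hτ _ _), heatKernel, ← hS]
  have b1 : |S / (2 * τ ^ 2) - d / (2 * τ)| ≤ (2 / τ₀ ^ 2 + d / τ₀) * (1 + S) := by
    have c1 : S / (2 * τ ^ 2) ≤ 2 / τ₀ ^ 2 * S := by
      rw [div_mul_eq_mul_div, div_le_div_iff₀ (by positivity) (by positivity)]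
      have : τ₀ ^ 2 ≤ 4 * τ ^ 2 := by nlinarith
      nlinarith
    have c2 : (d : ℝ) / (2 * τ) ≤ d / τ₀ := by
      gcongr; linarith
    have c3 : 0 ≤ S / (2 * τ ^ 2) := by positivity
    have c4 : 0 ≤ (d : ℝ) / (2 * τ) := by positivity
    have c5 : 0 ≤ (d : ℝ) / τ₀ * S := by positivity
    have c6 : 0 ≤ 2 / τ₀ ^ 2 := by positivity
    rw [abs_le]
    constructor <;> nlinarith
  have b2 : (2 * π * τ) ^ (-(d : ℝ) / 2) ≤ (π * τ₀) ^ (-(d : ℝ) / 2) := by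
    apply Real.rpow_le_rpow_of_nonpos (by positivity)
    · nlinarith [Real.pi_pos]
    · have : (0 : ℝ) ≤ d := by positivity
      linarith
  have b3 : Real.exp (-S / (2 * τ)) ≤ Real.exp (-(2 * (1 / (8 * τ₀))) * S) := by
    apply Real.exp_le_exp.2
    have : S / (4 * τ₀) ≤ S / (2 * τ) :=
      div_le_div_of_nonneg_left hS0 (by positivity) (by linarith)
    have e3 : 2 * (1 / (8 * τ₀)) * S = S / (4 * τ₀) := by field_simp; ring
    rw [neg_div, neg_mul, e3]
    linarith
  calc |S / (2 * τ ^ 2) - d / (2 * τ)| * ((2 * π * τ) ^ (-(d : ℝ) / 2) * Real.exp (-S / (2 * τ)))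
      ≤ (2 / τ₀ ^ 2 + d / τ₀) * (1 + S) * ((π * τ₀) ^ (-(d : ℝ) / 2) *
          Real.exp (-(2 * (1 / (8 * τ₀))) * S)) := by gcongr
    _ = (2 / τ₀ ^ 2 + d / τ₀) * (π * τ₀) ^ (-(d : ℝ) / 2) *
          ((1 + S) * Real.exp (-(2 * (1 / (8 * τ₀))) * S)) := by ring
    _ ≤ (2 / τ₀ ^ 2 + d / τ₀) * (π * τ₀) ^ (-(d : ℝ) / 2) *
          ((1 + 8 * τ₀) * Real.exp (-(1 / (8 * τ₀)) * S)) := by gcongr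
    _ = _ := by ring

theorem hasDerivAt_integral_mul {d : ℕ} {f : (Fin d → ℝ) → ℝ} {M : ℝ} (hfc : Continuous f)
    (hfM : ∀ y, |f y| ≤ M) {F F' : ℝ → (Fin d → ℝ) → ℝ} {g : (Fin d → ℝ) → ℝ} {a δ : ℝ}
    (hδ : 0 < δ) (hF : ∀ h, Continuous (F h)) (hF' : Continuous (F' a)) (hFi : Integrable (F a))
    (hg : Integrable g) (hbd : ∀ h ∈ Metric.ball a δ, ∀ y, |F' h y| ≤ g y)
    (hd : ∀ h ∈ Metric.ball a δ, ∀ y, HasDerivAt (fun h => F h y) (F' h y) h) :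
    Integrable (fun y => f y * F' a y) ∧
      HasDerivAt (fun h => ∫ y, f y * F h y) (∫ y, f y * F' a y) a := by
  refine hasDerivAt_integral_of_dominated_loc_of_deriv_le (F := fun h y => f y * F h y)
    (F' := fun h y => f y * F' h y) (bound := fun y => M * g y) (Metric.ball_mem_nhds a hδ)
    (Eventually.of_forall fun h => (hfc.mul (hF h)).aestronglyMeasurable)
    (hFi.bdd_mul hfc.aestronglyMeasurable (Eventually.of_forall hfM))
    (hfc.mul hF').aestronglyMeasurable (Eventually.of_forall fun y h hh => ?_) (hg.const_mul M)
    (Eventually.of_forall fun y h hh => (hd h hh y).const_mul (f y))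
  rw [Real.norm_eq_abs, abs_mul]
  exact mul_le_mul (hfM y) (hbd h hh y) (abs_nonneg _) ((abs_nonneg _).trans (hfM y))

theorem hasDerivAt_integral_heatKernel_space {d : ℕ} {f : (Fin d → ℝ) → ℝ} {M : ℝ}
    (hfc : Continuous f) (hfM : ∀ y, |f y| ≤ M) {τ : ℝ} (hτ : 0 < τ) (x : Fin d → ℝ) (k : Fin d)
    (a : ℝ) :
    Integrable (fun y => f y * (-(a - y k) / τ * heatKernel d τ (Function.update x k a) y)) ∧
      HasDerivAt (fun h => ∫ y, f y * heatKernel d τ (Function.update x k h) y)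
        (∫ y, f y * (-(a - y k) / τ * heatKernel d τ (Function.update x k a) y)) a := by
  refine hasDerivAt_integral_mul (F := fun h y => heatKernel d τ (Function.update x k h) y)
    (F' := fun h y => -(h - y k) / τ * heatKernel d τ (Function.update x k h) y)
    hfc hfM one_pos (fun h => continuous_heatKernel _ _) ?_ (integrable_heatKernel hτ _)
    ((integrable_exp_neg_mul_sqDist (b := 1 / (8 * τ)) (by positivity)
      (Function.update x k a)).const_mul _)
    (fun h hh y => abs_mul_heatKernel_update_le hτ x y k (A := 1 / τ)
      (Metric.mem_ball.1 hh).le (by positivity) ?_)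
    (fun h _ y => hasDerivAt_heatKernel_space τ x y k h)
  · have := continuous_heatKernel τ (Function.update x k a)
    fun_prop
  · have h1 := sq_le_sqDist (Function.update x k h) y k
    rw [Function.update_self] at h1
    rw [abs_div, abs_neg, abs_of_pos hτ, div_eq_mul_inv, mul_comm, ← one_div]
    gcongr
    have h2 := sq_abs (h - y k)
    nlinarith [sq_nonneg (|h - y k| - 1)]

theorem hasDerivAt_integral_heatKernel_space_two {d : ℕ} {f : (Fin d → ℝ) → ℝ} {M : ℝ}
    (hfc : Continuous f) (hfM : ∀ y, |f y| ≤ M) {τ : ℝ} (hτ : 0 < τ) (x : Fin d → ℝ) (k : Fin d)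
    (a : ℝ) :
    Integrable (fun y => f y * (((a - y k) ^ 2 / τ ^ 2 - 1 / τ) *
        heatKernel d τ (Function.update x k a) y)) ∧
      HasDerivAt
        (fun h => ∫ y, f y * (-(h - y k) / τ * heatKernel d τ (Function.update x k h) y))
        (∫ y, f y * (((a - y k) ^ 2 / τ ^ 2 - 1 / τ) *
          heatKernel d τ (Function.update x k a) y)) a := by
  have hi := (hasDerivAt_integral_heatKernel_space (f := fun _ => 1) (M := 1) continuous_const
    (by simp) hτ x k a).1
  simp only [one_mul] at hi
  refine hasDerivAt_integral_mul
    (F := fun h y => -(h - y k) / τ * heatKernel d τ (Function.update x k h) y)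
    (F' := fun h y => ((h - y k) ^ 2 / τ ^ 2 - 1 / τ) *
      heatKernel d τ (Function.update x k h) y)
    hfc hfM one_pos (fun h => ?_) ?_ hi
    ((integrable_exp_neg_mul_sqDist (b := 1 / (8 * τ)) (by positivity)
      (Function.update x k a)).const_mul _)
    (fun h hh y => abs_mul_heatKernel_update_le hτ x y k (A := 1 / τ ^ 2 + 1 / τ)
      (Metric.mem_ball.1 hh).le (by positivity) ?_)
    (fun h _ y => hasDerivAt_heatKernel_space_two τ x y k h)
  · have := continuous_heatKernel τ (Function.update x k h)
    fun_prop
  · have := continuous_heatKernel τ (Function.update x k a)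
    fun_prop
  · have h1 := sq_le_sqDist (Function.update x k h) y k
    rw [Function.update_self] at h1
    set S := sqDist (Function.update x k h) y
    have h2 : (h - y k) ^ 2 / τ ^ 2 ≤ 1 / τ ^ 2 * S := by
      rw [div_eq_mul_inv, mul_comm, ← one_div]
      gcongr
    have h3 : 0 ≤ (h - y k) ^ 2 / τ ^ 2 := by positivity
    have h4 : 0 < 1 / τ ^ 2 := by positivity
    have h5 : 0 < 1 / τ := by positivity
    have h6 : 0 ≤ 1 / τ * S := mul_nonneg h5.le (sqDist_nonneg _ _)
    rw [abs_le]
    constructor <;> nlinarith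

theorem hasDerivAt_integral_heatKernel_time {d : ℕ} {f : (Fin d → ℝ) → ℝ} {M : ℝ}
    (hfc : Continuous f) (hfM : ∀ y, |f y| ≤ M) {τ : ℝ} (hτ : 0 < τ) (x : Fin d → ℝ) :
    HasDerivAt (fun τ => ∫ y, f y * heatKernel d τ x y)
      (∫ y, f y * ((sqDist x y / (2 * τ ^ 2) - d / (2 * τ)) * heatKernel d τ x y)) τ := by
  have hball : ∀ r ∈ Metric.ball τ (τ / 2), τ / 2 < r ∧ r < 2 * τ := by
    intro r hr
    have := abs_lt.1 (Metric.mem_ball.1 hr)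
    constructor <;> linarith
  refine (hasDerivAt_integral_mul (F := fun τ y => heatKernel d τ x y)
    (F' := fun τ y => (sqDist x y / (2 * τ ^ 2) - d / (2 * τ)) * heatKernel d τ x y)
    hfc hfM (half_pos hτ) (fun h => continuous_heatKernel _ _) ?_ (integrable_heatKernel hτ _)
    ((integrable_exp_neg_mul_sqDist (b := 1 / (8 * τ)) (by positivity) x).const_mul _)
    (fun r hr y => abs_heatKernel_time_deriv_le hτ (hball r hr).1 (hball r hr).2 x y)
    (fun r hr y => hasDerivAt_heatKernel_time (by linarith [(hball r hr).1]) x y)).2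
  have := continuous_heatKernel τ x
  have := continuous_sqDist x
  fun_prop

/-- `z` solves `∂z/∂s = κ Δz` pointwise for `s > 0`. -/
def IsHeatSolution {d : ℕ} (κ : ℝ) (z : ℝ → (Fin d → ℝ) → ℝ) : Prop :=
  ∀ s > 0, ∀ x, ∃ (a : ℝ) (g : Fin d → ℝ → ℝ) (D : Fin d → ℝ),
    HasDerivAt (fun r => z r x) a s ∧
    (∀ k h, HasDerivAt (fun h => z s (Function.update x k h)) (g k h) h) ∧
    (∀ k, HasDerivAt (g k) (D k) (x k)) ∧ a = κ * ∑ k, D k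

theorem IsHeatSolution.sub {d : ℕ} {κ : ℝ} {z w : ℝ → (Fin d → ℝ) → ℝ}
    (hz : IsHeatSolution κ z) (hw : IsHeatSolution κ w) :
    IsHeatSolution κ fun s x => z s x - w s x := by
  intro s hs x
  obtain ⟨a, g, D, h1, h2, h3, h4⟩ := hz s hs x
  obtain ⟨a', g', D', h1', h2', h3', h4'⟩ := hw s hs x
  refine ⟨a - a', fun k h => g k h - g' k h, fun k => D k - D' k, h1.sub h1',
    fun k h => (h2 k h).sub (h2' k h), fun k => (h3 k).sub (h3' k), ?_⟩
  rw [h4, h4', Finset.sum_sub_distrib, mul_sub]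

/-- The second derivative is nonpositive at a global maximum. -/
theorem second_deriv_nonpos_of_isMax {g g' : ℝ → ℝ} {D a : ℝ}
    (hg : ∀ h, HasDerivAt g (g' h) h) (hD : HasDerivAt g' D a) (hmax : ∀ h, g h ≤ g a) :
    D ≤ 0 := by
  by_contra! hpos
  have hg' : deriv g = g' := funext fun h => (hg h).deriv
  have hmax' : IsLocalMax g a := Eventually.of_forall hmax
  have hmin : IsLocalMin g a := isLocalMin_of_deriv_deriv_pos (by rwa [hg', hD.deriv])
    hmax'.deriv_eq_zero (hg a).continuousAt
  have hconst : g =ᶠ[nhds a] fun _ => g a := hmin.mono fun h hh => le_antisymm (hmax h) hh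
  have h0 := hconst.deriv.deriv_eq
  rw [hg', hD.deriv] at h0
  simp at h0
  exact hpos.ne' h0

theorem deriv_nonneg_of_le_left {g : ℝ → ℝ} {D a b : ℝ} (hba : b < a) (hg : HasDerivAt g D a)
    (hmax : ∀ h ∈ Set.Icc b a, g h ≤ g a) : 0 ≤ D := by
  have h1 := (hasDerivAt_iff_tendsto_slope_left_right.1 hg).1
  refine ge_of_tendsto h1 ?_
  filter_upwards [Ioo_mem_nhdsLT hba] with h hh
  rw [slope_def_field]
  exact div_nonneg_of_nonpos (sub_nonpos.2 (hmax h ⟨hh.1.le, hh.2.le⟩)) (sub_nonpos.2 hh.2.le)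

/-- The maximum principle for bounded solutions of the heat equation on the whole space. -/
theorem IsHeatSolution.nonpos {d : ℕ} {κ M : ℝ} (hκ : 0 ≤ κ) {z : ℝ → (Fin d → ℝ) → ℝ}
    (hz : IsHeatSolution κ z)
    (hcont : ContinuousOn (fun p : ℝ × (Fin d → ℝ) => z p.1 p.2) {p | 0 ≤ p.1})
    (hM : ∀ s, 0 ≤ s → ∀ x, z s x ≤ M) (h0 : ∀ x, z 0 x ≤ 0) :
    ∀ s, 0 ≤ s → ∀ x, z s x ≤ 0 := by
  intro s₁ hs₁ x₁
  by_contra! hpos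
  set C : ℝ := 2 * κ * d + 1 with hC
  have hC0 : 0 < C := by positivity
  have hQ := sqDist_nonneg x₁ 0
  obtain ⟨ε, hε, hεφ⟩ : ∃ ε > 0, 0 < z s₁ x₁ - ε * (sqDist x₁ 0 + C * s₁) := by
    have hB : 0 < sqDist x₁ 0 + C * s₁ + 1 := by positivity
    refine ⟨z s₁ x₁ / (sqDist x₁ 0 + C * s₁ + 1), by positivity, ?_⟩
    rw [div_mul_eq_mul_div, sub_pos, div_lt_iff₀ hB]
    nlinarith
  have hM0 : 0 < M := hpos.trans_le (hM s₁ hs₁ x₁)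
  set φ : ℝ × (Fin d → ℝ) → ℝ := fun p => z p.1 p.2 - ε * (sqDist p.2 0 + C * p.1) with hφ
  have hρ : 0 < M / ε := by positivity
  set ρ : ℝ := M / ε + 1 with hρdef
  have hout : ∀ s, 0 ≤ s → ∀ x, x ∉ Metric.closedBall (0 : Fin d → ℝ) ρ → φ (s, x) ≤ 0 := by
    intro s hs x hx
    rw [mem_closedBall_zero_iff, pi_norm_le_iff_of_nonneg (by positivity)] at hx
    push Not at hx
    obtain ⟨k, hk⟩ := hx
    have h1 := sq_le_sqDist x 0 k
    rw [Pi.zero_apply, sub_zero, ← sq_abs] at h1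
    rw [Real.norm_eq_abs] at hk
    have h2 : M / ε ≤ sqDist x 0 := by nlinarith
    rw [div_le_iff₀ hε] at h2
    have h3 := hM s hs x
    have h4 : 0 ≤ ε * (C * s) := by positivity
    simp only [hφ]
    nlinarith
  have hx₁ : x₁ ∈ Metric.closedBall (0 : Fin d → ℝ) ρ := by
    by_contra hx
    exact absurd (hout s₁ hs₁ x₁ hx) (not_le.2 hεφ)
  have hφc : ContinuousOn φ (Set.Icc 0 s₁ ×ˢ Metric.closedBall (0 : Fin d → ℝ) ρ) := by
    refine (hcont.mono fun p hp => hp.1.1).sub (Continuous.continuousOn ?_)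
    unfold sqDist
    fun_prop
  obtain ⟨⟨s, x⟩, ⟨hs, hx⟩, hmax⟩ := (isCompact_Icc.prod (isCompact_closedBall _ _)).exists_isMaxOn
    ⟨(s₁, x₁), ⟨hs₁, le_rfl⟩, hx₁⟩ hφc
  have hφpos : 0 < φ (s, x) := hεφ.trans_le (hmax ⟨⟨hs₁, le_rfl⟩, hx₁⟩)
  have hglob : ∀ r ∈ Set.Icc 0 s₁, ∀ y, φ (r, y) ≤ φ (s, x) := by
    intro r hr y
    by_cases hy : y ∈ Metric.closedBall (0 : Fin d → ℝ) ρ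
    · exact hmax ⟨hr, hy⟩
    · exact (hout r hr.1 y hy).trans hφpos.le
  have hs0 : 0 < s := by
    refine hs.1.lt_of_ne fun hs' => ?_
    simp only at hs'
    subst hs'
    have h1 := h0 x
    have h2 : 0 ≤ ε * sqDist x 0 := mul_nonneg hε.le (sqDist_nonneg _ _)
    simp only [hφ] at hφpos
    nlinarith
  obtain ⟨a, g, D, h1, h2, h3, h4⟩ := hz s hs0 x
  have ha : 0 ≤ a - ε * C := by
    have hd : HasDerivAt (fun r => φ (r, x)) (a - ε * C) s := by
      have h5 : HasDerivAt (fun r : ℝ => ε * (sqDist x 0 + C * r)) (ε * C) s := by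
        simpa using (((hasDerivAt_id s).const_mul C).const_add (sqDist x 0)).const_mul ε
      exact h1.sub h5
    exact deriv_nonneg_of_le_left hs0 hd fun r hr => hglob r ⟨hr.1, hr.2.trans hs.2⟩ x
  have hD : ∀ k, D k ≤ 2 * ε := by
    intro k
    have hd : ∀ h, HasDerivAt (fun h => φ (s, Function.update x k h)) (g k h - ε * (2 * h)) h := by
      intro h
      refine (h2 k h).sub (HasDerivAt.const_mul ε ?_)
      simp only [sqDist_update, Pi.zero_apply, sub_zero]
      simpa using (((hasDerivAt_id h).pow 2).add_const (sqDist x 0 - x k ^ 2)).add_const (C * s)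
    have hd2 : HasDerivAt (fun h => g k h - ε * (2 * h)) (D k - ε * 2) (x k) := by
      refine (h3 k).sub (HasDerivAt.const_mul ε ?_)
      simpa using (hasDerivAt_id (x k)).const_mul (2 : ℝ)
    have := second_deriv_nonpos_of_isMax hd hd2 fun h => by
      rw [Function.update_eq_self]
      exact hglob s hs _
    linarith
  have hsum : ∑ k, D k ≤ d * (2 * ε) := by
    simpa using Finset.sum_le_sum fun k (_ : k ∈ Finset.univ) => hD k
  have := mul_le_mul_of_nonneg_left hsum hκ
  nlinarith

/-- The Gaussian average of `f` around `x` with variance `τ`. -/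
def gaussAvg {d : ℕ} (f : (Fin d → ℝ) → ℝ) (τ : ℝ) (x : Fin d → ℝ) : ℝ :=
  ∫ w : Fin d → ℝ, f (x + √τ • w) * heatKernel d 1 0 w

theorem gaussAvg_zero {d : ℕ} (f : (Fin d → ℝ) → ℝ) (x : Fin d → ℝ) : gaussAvg f 0 x = f x := by
  simp [gaussAvg, integral_const_mul, integral_heatKernel_one]

theorem continuous_gaussAvg {d : ℕ} {f : (Fin d → ℝ) → ℝ} {M : ℝ} (hfc : Continuous f)
    (hfM : ∀ y, |f y| ≤ M) : Continuous fun p : ℝ × (Fin d → ℝ) => gaussAvg f p.1 p.2 := by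
  have hk := continuous_heatKernel 1 (0 : Fin d → ℝ)
  refine continuous_of_dominated (bound := fun w => M * heatKernel d 1 0 w) (fun p => ?_)
    (fun p => Eventually.of_forall fun w => ?_) ((integrable_heatKernel one_pos 0).const_mul M)
    (Eventually.of_forall fun w => ?_)
  · exact Continuous.aestronglyMeasurable (by fun_prop)
  · rw [norm_mul, Real.norm_eq_abs, Real.norm_of_nonneg (heatKernel_nonneg one_pos _ _)]
    exact mul_le_mul_of_nonneg_right (hfM _) (heatKernel_nonneg one_pos _ _)
  · have := Real.continuous_sqrt
    fun_prop

theorem abs_gaussAvg_le {d : ℕ} {f : (Fin d → ℝ) → ℝ} {M : ℝ} (hfM : ∀ y, |f y| ≤ M)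
    (τ : ℝ) (x : Fin d → ℝ) : |gaussAvg f τ x| ≤ M := by
  have h := norm_integral_le_of_norm_le (f := fun w => f (x + √τ • w) * heatKernel d 1 0 w)
    ((integrable_heatKernel (d := d) one_pos 0).const_mul M) (Eventually.of_forall fun w => by
      rw [norm_mul, Real.norm_eq_abs, Real.norm_of_nonneg (heatKernel_nonneg one_pos _ _)]
      exact mul_le_mul_of_nonneg_right (hfM _) (heatKernel_nonneg one_pos _ _))
  rwa [integral_const_mul, integral_heatKernel_one, mul_one] at h

theorem gaussAvg_eq_integral_heatKernel {d : ℕ} (f : (Fin d → ℝ) → ℝ) {τ : ℝ} (hτ : 0 < τ)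
    (x : Fin d → ℝ) : gaussAvg f τ x = ∫ y, f y * heatKernel d τ x y := by
  have hs : 0 < √τ := Real.sqrt_pos.2 hτ
  have hk : ∀ w : Fin d → ℝ,
      heatKernel d 1 0 w = √τ ^ d * heatKernel d τ x (x + √τ • w) := by
    intro w
    have h1 : sqDist x (x + √τ • w) = τ * sqDist 0 w := by
      simp only [sqDist, Finset.mul_sum, Pi.add_apply, Pi.smul_apply, smul_eq_mul, Pi.zero_apply]
      refine Finset.sum_congr rfl fun k _ => ?_
      nth_rewrite 2 [← Real.sq_sqrt hτ.le]
      ring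
    have h2 : √τ ^ d * (2 * π * τ) ^ (-(d : ℝ) / 2) = (2 * π * 1) ^ (-(d : ℝ) / 2) := by
      rw [Real.mul_rpow (by positivity) hτ.le, mul_one, Real.sqrt_eq_rpow, ← Real.rpow_natCast,
        ← Real.rpow_mul hτ.le, mul_left_comm, ← Real.rpow_add hτ]
      ring_nf
      simp
    rw [heatKernel, heatKernel, h1, ← mul_assoc, h2]
    congr 2
    field_simp
  simp_rw [gaussAvg, hk]
  have h := Measure.integral_comp_smul (volume : Measure (Fin d → ℝ))
    (fun w => f (x + w) * (√τ ^ d * heatKernel d τ x (x + w))) √τ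
  rw [h, integral_add_left_eq_self (μ := volume)
    (fun y => f y * (√τ ^ d * heatKernel d τ x y)) x]
  simp_rw [mul_left_comm _ (√τ ^ d)]
  rw [integral_const_mul, Module.finrank_fin_fun, abs_of_pos (by positivity), smul_eq_mul,
    inv_mul_cancel_left₀ (by positivity)]

theorem isHeatSolution_gaussAvg {d : ℕ} {f : (Fin d → ℝ) → ℝ} {M c : ℝ} (hfc : Continuous f)
    (hfM : ∀ y, |f y| ≤ M) (hc : 0 < c) :
    IsHeatSolution (1 / 2 * c) fun s x => gaussAvg f (c * s) x := by
  intro s hs x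
  have hτ : 0 < c * s := mul_pos hc hs
  set τ := c * s with hτdef
  refine ⟨(∫ y, f y * ((sqDist x y / (2 * τ ^ 2) - d / (2 * τ)) * heatKernel d τ x y)) * c,
    fun k h => ∫ y, f y * (-(h - y k) / τ * heatKernel d τ (Function.update x k h) y),
    fun k => ∫ y, f y * (((x k - y k) ^ 2 / τ ^ 2 - 1 / τ) *
      heatKernel d τ (Function.update x k (x k)) y), ?_, fun k h => ?_,
    fun k => (hasDerivAt_integral_heatKernel_space_two hfc hfM hτ x k (x k)).2, ?_⟩
  · have h1 : HasDerivAt (fun r : ℝ => c * r) c s := by simpa using (hasDerivAt_id s).const_mul c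
    have h2 := (hasDerivAt_integral_heatKernel_time hfc hfM hτ x).comp s h1
    refine h2.congr_of_eventuallyEq ?_
    filter_upwards [lt_mem_nhds hs] with r hr
    exact gaussAvg_eq_integral_heatKernel f (mul_pos hc hr) x
  · exact (hasDerivAt_integral_heatKernel_space hfc hfM hτ x k h).2.congr_of_eventuallyEq
      (Eventually.of_forall fun _ => gaussAvg_eq_integral_heatKernel f hτ _)
  · rw [← integral_finsetSum _ fun k _ =>
      (hasDerivAt_integral_heatKernel_space_two hfc hfM hτ x k (x k)).1, ← integral_mul_const,
      ← integral_const_mul]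
    congr 1
    ext y
    simp only [Function.update_eq_self]
    rw [← Finset.mul_sum, ← Finset.sum_mul, Finset.sum_sub_distrib, ← Finset.sum_div]
    simp only [sqDist, Finset.sum_const, Finset.card_univ, Fintype.card_fin, nsmul_eq_mul]
    field_simp

/-- uniqueness of bounded solutions of the `j`-th heat-type PDE with
initial data `f` at `t_j = 0`: any such solution is
`u(t,x) = ∫ f(y) K^{BS}(t;x,y) dy`. -/
theorem brownian_sheet_heat_system_uniqueness
    (n d : ℕ) (hn : 1 ≤ n) (hd : 1 ≤ d) (j : Fin n)
    (f : (Fin d → ℝ) → ℝ) (hb : ∃ M, ∀ y, |f y| ≤ M) (hc : Continuous f)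
    (u : (Fin n → ℝ) → (Fin d → ℝ) → ℝ)
    (hu_bdd : ∃ M, ∀ (t : Fin n → ℝ) (x : Fin d → ℝ), (∀ i, 0 ≤ t i) → |u t x| ≤ M)
    (hu_cont : ContinuousOn (fun p : (Fin n → ℝ) × (Fin d → ℝ) => u p.1 p.2)
      {p : (Fin n → ℝ) × (Fin d → ℝ) | ∀ i, 0 ≤ p.1 i})
    (hC1 : ∀ (t : Fin n → ℝ) (x : Fin d → ℝ), (∀ i, 0 < t i) →
      ContDiffAt ℝ 1 (fun h : ℝ => u (Function.update t j h) x) (t j))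
    (hC2 : ∀ (t : Fin n → ℝ) (x : Fin d → ℝ), (∀ i, 0 < t i) →
      ContDiffAt ℝ 2 (u t) x)
    (hpde : ∀ (t : Fin n → ℝ) (x : Fin d → ℝ), (∀ i, 0 < t i) →
      pd j (fun t' => u t' x) t
        = (1 / 2) * (∏ i ∈ Finset.univ.erase j, t i) * lap (u t) x)
    (hinit : ∀ (t : Fin n → ℝ) (x : Fin d → ℝ), (∀ i, 0 ≤ t i) → t j = 0 →
      u t x = f x) :
    ∀ (t : Fin n → ℝ) (x : Fin d → ℝ), (∀ i, 0 < t i) →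
      u t x = ∫ y : Fin d → ℝ, f y * Kbs n d t x y := by
  intro t x ht
  obtain ⟨Mf, hMf⟩ := hb
  obtain ⟨Mu, hMu⟩ := hu_bdd
  set c : ℝ := ∏ i ∈ Finset.univ.erase j, t i
  have hcpos : 0 < c := Finset.prod_pos fun i _ => ht i
  have hpos : ∀ s : ℝ, 0 < s → ∀ i, 0 < Function.update t j s i := by
    intro s hs i
    rcases eq_or_ne i j with rfl | hi
    · simpa using hs
    · simpa [Function.update_of_ne hi] using ht i
  have hnonneg : ∀ s : ℝ, 0 ≤ s → ∀ i, 0 ≤ Function.update t j s i := by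
    intro s hs i
    rcases eq_or_ne i j with rfl | hi
    · simpa using hs
    · simpa [Function.update_of_ne hi] using (ht i).le
  have hv : IsHeatSolution (1 / 2 * c) fun s x => u (Function.update t j s) x := by
    intro s hs x
    have hd2 : ∀ k, ContDiff ℝ 2 fun h => u (Function.update t j s) (Function.update x k h) :=
      fun k => contDiff_iff_contDiffAt.2 fun h =>
        (hC2 _ _ (hpos s hs)).comp h (contDiff_update 2 x k).contDiffAt
    refine ⟨deriv (fun r => u (Function.update t j r) x) s,
      fun k => deriv fun h => u (Function.update t j s) (Function.update x k h), _, ?_,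
      fun k h => ((hd2 k).differentiable two_ne_zero h).hasDerivAt, fun k =>
        (((contDiff_succ_iff_deriv (n := 1)).1 (hd2 k)).2.2.differentiable one_ne_zero _).hasDerivAt,
      ?_⟩
    · have h1 := hC1 _ x (hpos s hs)
      simp only [Function.update_idem, Function.update_self] at h1
      exact (h1.differentiableAt one_ne_zero).hasDerivAt
    · have h1 := hpde _ x (hpos s hs)
      have h2 : ∏ i ∈ Finset.univ.erase j, Function.update t j s i = c :=
        Finset.prod_congr rfl fun i hi => Function.update_of_ne (Finset.ne_of_mem_erase hi) _ _
      rw [h2] at h1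
      simpa only [pd, lap, Function.update_idem, Function.update_self] using h1
  have hw := isHeatSolution_gaussAvg hc hMf hcpos
  have hvc : ContinuousOn (fun p : ℝ × (Fin d → ℝ) => u (Function.update t j p.1) p.2)
      {p | 0 ≤ p.1} := by
    refine hu_cont.comp (f := fun p : ℝ × (Fin d → ℝ) => (Function.update t j p.1, p.2))
      (Continuous.continuousOn ?_) fun p hp => hnonneg p.1 hp
    have h1 : Continuous fun p : ℝ × (Fin d → ℝ) => Function.update t j p.1 :=
      continuous_const.update j continuous_fst
    exact h1.prodMk continuous_snd
  have hwc : Continuous fun p : ℝ × (Fin d → ℝ) => gaussAvg f (c * p.1) p.2 :=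
    (continuous_gaussAvg hc hMf).comp (f := fun p : ℝ × (Fin d → ℝ) => (c * p.1, p.2))
      (by fun_prop)
  have hinit0 : ∀ x, u (Function.update t j 0) x = gaussAvg f (c * 0) x := by
    intro x
    rw [mul_zero, gaussAvg_zero, hinit _ x (hnonneg 0 le_rfl) (Function.update_self ..)]
  have hvM : ∀ s : ℝ, 0 ≤ s → ∀ x, |u (Function.update t j s) x| ≤ Mu := fun s hs x =>
    hMu _ x (hnonneg s hs)
  have hwM : ∀ s x, |gaussAvg f (c * s) x| ≤ Mf := fun s x => abs_gaussAvg_le hMf _ x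
  have hκ : 0 ≤ 1 / 2 * c := by positivity
  have hle := (hv.sub hw).nonpos (M := Mu + Mf) hκ (hvc.sub hwc.continuousOn)
    (fun s hs x => by linarith [abs_le.1 (hvM s hs x), abs_le.1 (hwM s x)])
    (fun x => (sub_eq_zero.2 (hinit0 x)).le) (t j) (ht j).le x
  have hge := (hw.sub hv).nonpos (M := Mu + Mf) hκ (hwc.continuousOn.sub hvc)
    (fun s hs x => by linarith [abs_le.1 (hvM s hs x), abs_le.1 (hwM s x)])
    (fun x => (sub_eq_zero.2 (hinit0 x).symm).le) (t j) (ht j).le x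
  simp only [Function.update_eq_self] at hle hge
  have hprod : c * t j = ∏ i, t i := Finset.prod_erase_mul _ _ (Finset.mem_univ j)
  rw [le_antisymm (sub_nonpos.1 hle) (sub_nonpos.1 hge), hprod,
    gaussAvg_eq_integral_heatKernel f (Finset.prod_pos fun i _ => ht i)]
  rfl
end
end

section
/- Let n = 2, let f : ℝ^d → ℝ be bounded and continuous, and define u(t₁,t₂,x) = ∫_{ℝ^d} f(y) K^{BS}((t₁,t₂);x,y) dy for t₁, t₂ > 0 and x ∈ ℝ^d. Then u satisfies the fourth order linear PDE ∂²u/∂t₁∂t₂ = (1/2) Δ_x u + (t₁ t₂ / 4) Δ_x² u for all t₁, t₂ > 0 and x ∈ ℝ^d. -/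
open MeasureTheory Real Filter Finset

noncomputable section

/-- The `j`-th space derivative of the heat kernel `Kbm σ`, defined through the Hermite recursion. -/
def heatDeriv (σ : ℝ) : ℕ → ℝ → ℝ
  | 0, s => Kbm σ s
  | 1, s => -(s / σ) * Kbm σ s
  | j + 2, s => -(s * heatDeriv σ (j + 1) s + (j + 1) * heatDeriv σ j s) / σ

theorem heatDeriv_add_two (σ : ℝ) (j : ℕ) (s : ℝ) :
    heatDeriv σ (j + 2) s = -(s * heatDeriv σ (j + 1) s + (j + 1) * heatDeriv σ j s) / σ :=
  rfl

theorem hasDerivAt_Kbm_space (σ s : ℝ) : HasDerivAt (Kbm σ) (-(s / σ) * Kbm σ s) s := by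
  have h : HasDerivAt (fun s : ℝ => -(s ^ 2) / (2 * σ)) (-(s / σ)) s := by
    refine (((hasDerivAt_id s).pow 2).neg.div_const (2 * σ)).congr_deriv ?_
    rcases eq_or_ne σ 0 with rfl | hσ
    · simp
    · simp; field_simp
  refine (h.exp.const_mul ((2 * π * σ) ^ (-(1 : ℝ) / 2))).congr_deriv ?_
  rw [Kbm]; ring

theorem hasDerivAt_Kbm_time {σ : ℝ} (hσ : 0 < σ) (s : ℝ) :
    HasDerivAt (fun σ => Kbm σ s) ((s ^ 2 / σ ^ 2 - 1 / σ) / 2 * Kbm σ s) σ := by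
  have hpos : 0 < 2 * π * σ := by positivity
  have h1 : HasDerivAt (fun σ : ℝ => -(s ^ 2) / (2 * σ)) (s ^ 2 / (2 * σ ^ 2)) σ := by
    refine ((hasDerivAt_const σ (-(s ^ 2))).div ((hasDerivAt_id σ).const_mul 2)
      (by simpa using hσ.ne')).congr_deriv ?_
    simp; field_simp
  have h2 : HasDerivAt (fun σ : ℝ => (2 * π * σ) ^ (-(1 : ℝ) / 2))
      (-(1 / (2 * σ)) * (2 * π * σ) ^ (-(1 : ℝ) / 2)) σ := by
    refine (((hasDerivAt_id σ).const_mul (2 * π)).rpow_const (Or.inl hpos.ne')).congr_deriv ?_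
    rw [id, rpow_sub_one hpos.ne']
    field_simp
  refine (h2.mul h1.exp).congr_deriv ?_
  rw [Kbm]; field_simp; ring

theorem hasDerivAt_heatDeriv_space {σ : ℝ} (hσ : 0 < σ) (j : ℕ) (s : ℝ) :
    HasDerivAt (heatDeriv σ j) (heatDeriv σ (j + 1) s) s := by
  induction j using Nat.twoStepInduction with
  | zero => exact hasDerivAt_Kbm_space σ s
  | one =>
    refine ((((hasDerivAt_id s).div_const σ).neg).mul (hasDerivAt_Kbm_space σ s)).congr_deriv ?_
    simp [heatDeriv]; field_simp
  | more j h0 h1 =>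
    refine (((((hasDerivAt_id s).mul h1).add (h0.const_mul ((j : ℝ) + 1))).neg).div_const
      σ).congr_deriv ?_
    rw [show j + 2 + 1 = j + 1 + 2 from rfl, heatDeriv_add_two σ (j + 1)]; simp; ring

theorem hasDerivAt_heatDeriv_time {σ : ℝ} (hσ : 0 < σ) (j : ℕ) (s : ℝ) :
    HasDerivAt (fun σ => heatDeriv σ j s) (heatDeriv σ (j + 2) s / 2) σ := by
  induction j using Nat.twoStepInduction with
  | zero =>
    refine (hasDerivAt_Kbm_time hσ s).congr_deriv ?_
    simp [heatDeriv]; field_simp; ring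
  | one =>
    refine ((((hasDerivAt_const σ s).div (hasDerivAt_id σ) hσ.ne').neg).mul
      (hasDerivAt_Kbm_time hσ s)).congr_deriv ?_
    simp [heatDeriv]; field_simp; ring
  | more j h0 h1 =>
    refine ((((h1.const_mul s).add (h0.const_mul ((j : ℝ) + 1))).neg).div (hasDerivAt_id σ)
      hσ.ne').congr_deriv ?_
    have h4 : σ * heatDeriv σ (j + 4) s
        = -(s * heatDeriv σ (j + 3) s + (j + 3) * heatDeriv σ (j + 2) s) := by
      rw [heatDeriv_add_two σ (j + 2)]; push_cast; field_simp; ring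
    have h2 : σ * heatDeriv σ (j + 2) s
        = -(s * heatDeriv σ (j + 1) s + (j + 1) * heatDeriv σ j s) := by
      rw [heatDeriv_add_two σ j]; field_simp
    simp only [id, Pi.add_apply, Pi.neg_apply]
    rw [div_eq_iff (by positivity)]
    linear_combination (-σ / 2) * h4 + h2

/-- Space derivatives of the heat kernel decay faster than any exponential, locally uniformly in
time. -/
theorem heatDeriv_le_exp {a b : ℝ} (ha : 0 < a) (j : ℕ) :
    ∀ c : ℝ, ∃ C, 0 ≤ C ∧ ∀ σ ∈ Set.Icc a b, ∀ s,
      |heatDeriv σ j s| ≤ C * Real.exp (-(c * |s|)) := by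
  have step : ∀ (C c s : ℝ), 0 ≤ C →
      |s| * (C * Real.exp (-((c + 1) * |s|))) ≤ C * Real.exp (-(c * |s|)) := by
    intro C c s hC
    have h : |s| * Real.exp (-|s|) ≤ 1 := by
      rw [Real.exp_neg, ← div_eq_mul_inv, div_le_one (Real.exp_pos _)]
      linarith [Real.add_one_le_exp |s|]
    have e : Real.exp (-((c + 1) * |s|)) = Real.exp (-|s|) * Real.exp (-(c * |s|)) := by
      rw [← Real.exp_add]; ring_nf
    rw [e]
    calc _ = (|s| * Real.exp (-|s|)) * (C * Real.exp (-(c * |s|))) := by ring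
      _ ≤ 1 * (C * Real.exp (-(c * |s|))) := by gcongr
      _ = _ := one_mul _
  have base : ∀ c : ℝ, ∃ C, 0 ≤ C ∧ ∀ σ ∈ Set.Icc a b, ∀ s,
      |Kbm σ s| ≤ C * Real.exp (-(c * |s|)) := by
    intro c
    refine ⟨(2 * π * a) ^ (-(1 : ℝ) / 2) * Real.exp (c ^ 2 * b / 2), by positivity, ?_⟩
    rintro σ ⟨h1, h2⟩ s
    have hσ : 0 < σ := ha.trans_le h1
    have hK : 0 ≤ Kbm σ s := by rw [Kbm]; positivity
    rw [abs_of_nonneg hK, Kbm, mul_assoc _ (Real.exp (c ^ 2 * b / 2)), ← Real.exp_add]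
    have hp : (2 * π * σ) ^ (-(1 : ℝ) / 2) ≤ (2 * π * a) ^ (-(1 : ℝ) / 2) :=
      Real.rpow_le_rpow_of_nonpos (by positivity) (by gcongr) (by norm_num)
    refine mul_le_mul hp (Real.exp_le_exp.2 ?_) (Real.exp_pos _).le (by positivity)
    rw [div_le_iff₀ (by positivity)]
    have hs : s ^ 2 = |s| ^ 2 := (sq_abs s).symm
    have hb : c ^ 2 * σ * σ ≤ c ^ 2 * b * σ := by gcongr
    rw [hs]
    nlinarith [sq_nonneg (|s| - c * σ)]
  induction j using Nat.twoStepInduction with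
  | zero => exact base
  | one =>
    intro c
    obtain ⟨C, hC, h⟩ := base (c + 1)
    refine ⟨C / a, by positivity, fun σ hσ s => ?_⟩
    have hσ0 : 0 < σ := ha.trans_le hσ.1
    rw [heatDeriv, abs_mul, abs_neg, abs_div, abs_of_pos hσ0]
    calc |s| / σ * |Kbm σ s| = |s| * |Kbm σ s| / σ := by ring
      _ ≤ |s| * (C * Real.exp (-((c + 1) * |s|))) / a := by
        gcongr
        · exact h σ hσ s
        · exact hσ.1
      _ ≤ C * Real.exp (-(c * |s|)) / a := div_le_div_of_nonneg_right (step C c s hC) ha.le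
      _ = _ := by ring
  | more j h0 h1 =>
    intro c
    obtain ⟨C, hC, h⟩ := h1 (c + 1)
    obtain ⟨D, hD, h'⟩ := h0 c
    refine ⟨(C + (j + 1) * D) / a, by positivity, fun σ hσ s => ?_⟩
    have hσ0 : 0 < σ := ha.trans_le hσ.1
    rw [heatDeriv, abs_div, abs_neg, abs_of_pos hσ0]
    have hj : |((j : ℝ) + 1)| = j + 1 := abs_of_nonneg (by positivity)
    calc |s * heatDeriv σ (j + 1) s + (j + 1) * heatDeriv σ j s| / σ
        ≤ (|s| * |heatDeriv σ (j + 1) s| + (j + 1) * |heatDeriv σ j s|) / σ := by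
          gcongr
          refine (abs_add_le _ _).trans_eq ?_
          rw [abs_mul, abs_mul, hj]
      _ ≤ (|s| * (C * Real.exp (-((c + 1) * |s|))) + (j + 1) * (D * Real.exp (-(c * |s|)))) / a := by
        gcongr
        · exact h σ hσ s
        · exact h' σ hσ s
        · exact hσ.1
      _ ≤ (C * Real.exp (-(c * |s|)) + (j + 1) * (D * Real.exp (-(c * |s|)))) / a :=
        div_le_div_of_nonneg_right (add_le_add_left (step C c s hC) _) ha.le
      _ = _ := by ring

theorem integrable_exp_neg_abs : Integrable fun x : ℝ => Real.exp (-|x|) := by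
  refine (integrable_inv_one_add_sq.const_mul 2).mono' (by fun_prop) (ae_of_all _ fun x => ?_)
  rw [Real.norm_eq_abs, abs_of_pos (Real.exp_pos _), Real.exp_neg, ← div_eq_mul_inv,
    inv_eq_one_div, div_le_div_iff₀ (Real.exp_pos _) (by positivity)]
  nlinarith [Real.quadratic_le_exp_of_nonneg (abs_nonneg x), abs_nonneg x, sq_abs x]

section

variable {d : ℕ}

/-- The mixed space derivative of order `α` of the `d`-dimensional heat kernel at time `σ`. -/
def heatMulti (α : Fin d → ℕ) (σ : ℝ) (z : Fin d → ℝ) : ℝ :=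
  ∏ i, heatDeriv σ (α i) (z i)

/-- The integral of `f` against a space derivative of the heat kernel centred at `x`. -/
def heatInt (f : (Fin d → ℝ) → ℝ) (α : Fin d → ℕ) (σ : ℝ) (x : Fin d → ℝ) : ℝ :=
  ∫ y, f y * heatMulti α σ (x - y)

theorem continuous_heatMulti (α : Fin d → ℕ) {σ : ℝ} (hσ : 0 < σ) :
    Continuous (heatMulti α σ) := by
  have h : ∀ j, Continuous (heatDeriv σ j) := fun j =>
    continuous_iff_continuousAt.2 fun s => (hasDerivAt_heatDeriv_space hσ j s).continuousAt
  exact continuous_finsetProd _ fun i _ => (h (α i)).comp (continuous_apply i)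

theorem heatMulti_add_single (α : Fin d → ℕ) (k : Fin d) (m : ℕ) (σ : ℝ) (z : Fin d → ℝ) :
    heatMulti (α + Pi.single k m) σ z =
      (∏ i ∈ univ.erase k, heatDeriv σ (α i) (z i)) * heatDeriv σ (α k + m) (z k) := by
  rw [heatMulti, ← Finset.prod_erase_mul _ _ (mem_univ k)]
  congr 1
  · refine Finset.prod_congr rfl fun i hi => ?_
    simp [Pi.single_eq_of_ne (Finset.ne_of_mem_erase hi)]
  · simp

theorem hasDerivAt_heatMulti_space (α : Fin d → ℕ) (k : Fin d) {σ : ℝ} (hσ : 0 < σ)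
    (x y : Fin d → ℝ) (h : ℝ) :
    HasDerivAt (fun h => heatMulti α σ (Function.update x k h - y))
      (heatMulti (α + Pi.single k 1) σ (Function.update x k h - y)) h := by
  have hprod : ∀ h, ∏ i ∈ univ.erase k, heatDeriv σ (α i) ((Function.update x k h - y) i)
      = ∏ i ∈ univ.erase k, heatDeriv σ (α i) ((x - y) i) := fun h =>
    Finset.prod_congr rfl fun i hi => by
      simp [Function.update_of_ne (Finset.ne_of_mem_erase hi)]
  rw [heatMulti_add_single, hprod]
  have hfun : (fun h => heatMulti α σ (Function.update x k h - y)) = fun h =>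
      (∏ i ∈ univ.erase k, heatDeriv σ (α i) ((x - y) i)) * heatDeriv σ (α k) (h - y k) := by
    funext h
    have := heatMulti_add_single α k 0 σ (Function.update x k h - y)
    rw [hprod] at this
    simpa using this
  rw [hfun]
  have := (hasDerivAt_heatDeriv_space hσ (α k) (h - y k)).comp_sub_const h (y k)
  simpa using this.const_mul (∏ i ∈ univ.erase k, heatDeriv σ (α i) ((x - y) i))

theorem hasDerivAt_heatMulti_time (α : Fin d → ℕ) {σ : ℝ} (hσ : 0 < σ) (z : Fin d → ℝ) :
    HasDerivAt (fun σ => heatMulti α σ z)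
      (∑ k, heatMulti (α + Pi.single k 2) σ z / 2) σ := by
  refine (HasDerivAt.fun_finsetProd fun i _ =>
    hasDerivAt_heatDeriv_time hσ (α i) (z i)).congr_deriv ?_
  refine Finset.sum_congr rfl fun k _ => ?_
  rw [heatMulti_add_single, smul_eq_mul, mul_div_assoc]

/-- An integrable function dominating all heat kernel derivatives centred near `x`. -/
def expBound (x y : Fin d → ℝ) : ℝ := ∏ i, Real.exp (-|x i - y i|)

theorem integrable_expBound (x : Fin d → ℝ) : Integrable (expBound x) :=
  Integrable.fintype_prod (f := fun i (s : ℝ) => Real.exp (-|x i - s|))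
    fun i => integrable_exp_neg_abs.comp_sub_left (x i)

theorem heatMulti_le_expBound {a b : ℝ} (ha : 0 < a) (α : Fin d → ℕ) :
    ∃ C, 0 ≤ C ∧ ∀ σ ∈ Set.Icc a b, ∀ x z y : Fin d → ℝ, (∀ i, |z i - x i| ≤ 1) →
      |heatMulti α σ (z - y)| ≤ C * expBound x y := by
  choose C hC h using fun i => heatDeriv_le_exp (b := b) ha (α i) 1
  refine ⟨∏ i, (C i * Real.exp 1), Finset.prod_nonneg fun i _ => mul_nonneg (hC i) (Real.exp_pos _).le,
    fun σ hσ x z y hz => ?_⟩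
  rw [heatMulti, expBound, Finset.abs_prod, ← Finset.prod_mul_distrib]
  refine Finset.prod_le_prod (fun i _ => abs_nonneg _) fun i _ => (h i σ hσ _).trans ?_
  rw [mul_assoc, ← Real.exp_add]
  refine mul_le_mul_of_nonneg_left (Real.exp_le_exp.2 ?_) (hC i)
  have := abs_sub_le (x i) (z i) (y i)
  rw [abs_sub_comm (x i) (z i)] at this
  simp only [Pi.sub_apply]
  linarith [hz i]

variable {f : (Fin d → ℝ) → ℝ} {M : ℝ}

theorem continuous_mul_heatMulti (hc : Continuous f) (α : Fin d → ℕ) {σ : ℝ} (hσ : 0 < σ)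
    (x : Fin d → ℝ) : Continuous fun y => f y * heatMulti α σ (x - y) :=
  hc.mul ((continuous_heatMulti α hσ).comp (continuous_const.sub continuous_id))

theorem abs_mul_heatMulti_le (hb : ∀ y, |f y| ≤ M) {a b : ℝ} (ha : 0 < a) (α : Fin d → ℕ) :
    ∃ C, ∀ σ ∈ Set.Icc a b, ∀ x z y : Fin d → ℝ, (∀ i, |z i - x i| ≤ 1) →
      |f y * heatMulti α σ (z - y)| ≤ C * expBound x y := by
  obtain ⟨C, hC, h⟩ := heatMulti_le_expBound (b := b) ha α
  refine ⟨M * C, fun σ hσ x z y hz => ?_⟩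
  rw [abs_mul, mul_assoc]
  exact mul_le_mul (hb y) (h σ hσ x z y hz) (abs_nonneg _) ((abs_nonneg _).trans (hb y))

theorem integrable_mul_heatMulti (hc : Continuous f) (hb : ∀ y, |f y| ≤ M) (α : Fin d → ℕ)
    {σ : ℝ} (hσ : 0 < σ) (x : Fin d → ℝ) :
    Integrable fun y => f y * heatMulti α σ (x - y) := by
  obtain ⟨C, h⟩ := abs_mul_heatMulti_le (b := σ) hb hσ α
  exact ((integrable_expBound x).const_mul C).mono'
    (continuous_mul_heatMulti hc α hσ x).aestronglyMeasurable
    (ae_of_all _ fun y => h σ ⟨le_rfl, le_rfl⟩ x x y (by simp))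

theorem hasDerivAt_heatInt_space (hc : Continuous f) (hb : ∀ y, |f y| ≤ M) (α : Fin d → ℕ)
    (k : Fin d) {σ : ℝ} (hσ : 0 < σ) (x : Fin d → ℝ) :
    HasDerivAt (fun h => heatInt f α σ (Function.update x k h))
      (heatInt f (α + Pi.single k 1) σ x) (x k) := by
  obtain ⟨C, h⟩ := abs_mul_heatMulti_le (b := σ) hb hσ (α + Pi.single k 1)
  have key := (hasDerivAt_integral_of_dominated_loc_of_deriv_le (μ := volume) (x₀ := x k)
    (F := fun h y => f y * heatMulti α σ (Function.update x k h - y))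
    (F' := fun h y => f y * heatMulti (α + Pi.single k 1) σ (Function.update x k h - y))
    (bound := fun y => C * expBound x y) (Metric.ball_mem_nhds (x k) one_pos)
    (Eventually.of_forall fun h => (continuous_mul_heatMulti hc α hσ _).aestronglyMeasurable)
    (integrable_mul_heatMulti hc hb α hσ _)
    (continuous_mul_heatMulti hc _ hσ _).aestronglyMeasurable
    (ae_of_all _ fun y s hs => h σ ⟨le_rfl, le_rfl⟩ x _ y fun i => ?_)
    ((integrable_expBound x).const_mul C)
    (ae_of_all _ fun y s _ => (hasDerivAt_heatMulti_space α k hσ x y s).const_mul (f y))).2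
  · simpa only [Function.update_eq_self] using! key
  · rcases eq_or_ne i k with rfl | hi
    · simpa [Real.dist_eq] using (Metric.mem_ball.1 hs).le
    · simp [hi]

theorem hasDerivAt_heatInt_time (hc : Continuous f) (hb : ∀ y, |f y| ≤ M) (α : Fin d → ℕ)
    {σ : ℝ} (hσ : 0 < σ) (x : Fin d → ℝ) :
    HasDerivAt (fun σ => heatInt f α σ x)
      (∑ k, heatInt f (α + Pi.single k 2) σ x / 2) σ := by
  choose C h using fun k : Fin d =>
    abs_mul_heatMulti_le (b := 2 * σ) hb (half_pos hσ) (α + Pi.single k 2)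
  have hs : Set.Icc (σ / 2) (2 * σ) ∈ nhds σ := Icc_mem_nhds (by linarith) (by linarith)
  have hpos : ∀ s ∈ Set.Icc (σ / 2) (2 * σ), 0 < s := fun s hs => (half_pos hσ).trans_le hs.1
  have h_bound : ∀ y, ∀ s ∈ Set.Icc (σ / 2) (2 * σ),
      ‖∑ k, f y * heatMulti (α + Pi.single k 2) s (x - y) / 2‖ ≤ ∑ k, C k * expBound x y / 2 := by
    refine fun y s hs => (norm_sum_le _ _).trans (Finset.sum_le_sum fun k _ => ?_)
    rw [norm_div, Real.norm_eq_abs, Real.norm_two]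
    exact div_le_div_of_nonneg_right (h k s hs x x y (by simp)) zero_le_two
  have h_diff : ∀ y, ∀ s ∈ Set.Icc (σ / 2) (2 * σ),
      HasDerivAt (fun σ => f y * heatMulti α σ (x - y))
        (∑ k, f y * heatMulti (α + Pi.single k 2) s (x - y) / 2) s := by
    refine fun y s hs =>
      ((hasDerivAt_heatMulti_time α (hpos s hs) (x - y)).const_mul (f y)).congr_deriv ?_
    simp only [Finset.mul_sum, mul_div_assoc]
  have h_int' : Integrable fun y => ∑ k, f y * heatMulti (α + Pi.single k 2) σ (x - y) / 2 :=
    integrable_finsetSum _ fun k _ => (integrable_mul_heatMulti hc hb _ hσ x).div_const 2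
  have h_int : Integrable fun y => ∑ k, C k * expBound x y / 2 :=
    integrable_finsetSum _ fun k _ => ((integrable_expBound x).const_mul (C k)).div_const 2
  have h_meas : ∀ᶠ s in nhds σ,
      AEStronglyMeasurable (fun y => f y * heatMulti α s (x - y)) volume :=
    eventually_of_mem hs fun s hs =>
      (continuous_mul_heatMulti hc α (hpos s hs) x).aestronglyMeasurable
  have key : HasDerivAt (fun σ => heatInt f α σ x)
      (∫ y, ∑ k, f y * heatMulti (α + Pi.single k 2) σ (x - y) / 2) σ :=
    (hasDerivAt_integral_of_dominated_loc_of_deriv_le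
      (F' := fun s y => ∑ k, f y * heatMulti (α + (Pi.single k 2 : Fin d → ℕ)) s (x - y) / 2)
      hs h_meas (integrable_mul_heatMulti hc hb α hσ x) h_int'.aestronglyMeasurable
      (ae_of_all _ h_bound) h_int (ae_of_all _ h_diff)).2
  refine key.congr_deriv ?_
  rw [integral_finsetSum _ fun k _ => (integrable_mul_heatMulti hc hb _ hσ x).div_const 2]
  simp only [integral_div, heatInt]

theorem pd_sum_heatInt (hc : Continuous f) (hb : ∀ y, |f y| ≤ M) {ι : Type*} [Fintype ι]
    (A : ι → Fin d → ℕ) (k : Fin d) {σ : ℝ} (hσ : 0 < σ) :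
    pd k (fun x => ∑ j, heatInt f (A j) σ x) =
      fun x => ∑ j, heatInt f (A j + Pi.single k 1) σ x :=
  funext fun x =>
    (HasDerivAt.fun_sum fun j _ => hasDerivAt_heatInt_space hc hb (A j) k hσ x).deriv

theorem lap_sum_heatInt (hc : Continuous f) (hb : ∀ y, |f y| ≤ M) {ι : Type*} [Fintype ι]
    (A : ι → Fin d → ℕ) {σ : ℝ} (hσ : 0 < σ) :
    lap (fun x => ∑ j, heatInt f (A j) σ x) =
      fun x => ∑ j, ∑ k, heatInt f (A j + Pi.single k 2) σ x := by
  funext x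
  rw [Finset.sum_comm]
  refine Finset.sum_congr rfl fun k _ => ?_
  rw [pd_sum_heatInt hc hb A k hσ, pd_sum_heatInt hc hb _ k hσ]
  simp only [add_assoc, ← Pi.single_add, Nat.reduceAdd]

theorem lap_heatInt (hc : Continuous f) (hb : ∀ y, |f y| ≤ M) (α : Fin d → ℕ) {σ : ℝ}
    (hσ : 0 < σ) :
    lap (heatInt f α σ) = fun x => ∑ k, heatInt f (α + Pi.single k 2) σ x := by
  simpa using lap_sum_heatInt hc hb (fun _ : Unit => α) hσ

theorem Kbs_two_eq_heatMulti {a b : ℝ} (h : 0 < a * b) (x y : Fin d → ℝ) :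
    Kbs 2 d ![a, b] x y = heatMulti 0 (a * b) (x - y) := by
  simp only [heatMulti, heatDeriv, Kbm, Kbs, Fin.prod_univ_two, Matrix.cons_val_zero,
    Matrix.cons_val_one, Pi.sub_apply]
  rw [Finset.prod_mul_distrib, ← Real.exp_sum, Finset.prod_const, Finset.card_univ, Fintype.card_fin,
    ← Real.rpow_mul_natCast (by positivity), ← Finset.sum_div, Finset.sum_neg_distrib]
  congr 2
  ring

end

/-- for `n = 2`, `u(t₁,t₂,x) = ∫ f(y) K^{BS}((t₁,t₂);x,y) dy` satisfies
the fourth order linear PDE `∂²u/∂t₁∂t₂ = (1/2)Δ_x u + (t₁t₂/4)Δ_x² u`. -/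
theorem brownian_sheet_fourth_order_pde_two_params
    (d : ℕ) (hd : 1 ≤ d)
    (f : (Fin d → ℝ) → ℝ) (hb : ∃ M, ∀ y, |f y| ≤ M) (hc : Continuous f)
    (u : ℝ → ℝ → (Fin d → ℝ) → ℝ)
    (hu : ∀ t₁ t₂ x, u t₁ t₂ x = ∫ y : Fin d → ℝ, f y * Kbs 2 d ![t₁, t₂] x y)
    (t₁ t₂ : ℝ) (h₁ : 0 < t₁) (h₂ : 0 < t₂) (x : Fin d → ℝ) :
    deriv (fun a => deriv (fun b => u a b x) t₂) t₁
      = (1 / 2) * lap (u t₁ t₂) x + (t₁ * t₂ / 4) * lap (lap (u t₁ t₂)) x := by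
  obtain ⟨M, hM⟩ := hb
  have hu' : ∀ {a b : ℝ}, 0 < a * b → u a b = heatInt f 0 (a * b) := fun h => by
    funext x
    simp only [hu, heatInt, Kbs_two_eq_heatMulti h]
  have hpos : 0 < t₁ * t₂ := mul_pos h₁ h₂
  have hd2 : ∀ a : ℝ, 0 < a → deriv (fun b => u a b x) t₂ =
      (∑ k, heatInt f (0 + Pi.single k 2) (a * t₂) x / 2) * a := by
    intro a ha
    have hev : (fun b => u a b x) =ᶠ[nhds t₂] fun b => heatInt f 0 (a * b) x := by
      filter_upwards [lt_mem_nhds h₂] with b hb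
      rw [hu' (mul_pos ha hb)]
    rw [hev.deriv_eq]
    have hlin : HasDerivAt (fun b => a * b) a t₂ := by
      simpa using (hasDerivAt_id t₂).const_mul a
    exact ((hasDerivAt_heatInt_time hc hM 0 (mul_pos ha h₂) x).comp t₂ hlin).deriv
  have hev : (fun a => deriv (fun b => u a b x) t₂) =ᶠ[nhds t₁] fun a =>
      (∑ k, heatInt f (0 + Pi.single k 2) (a * t₂) x / 2) * a := by
    filter_upwards [lt_mem_nhds h₁] with a ha using hd2 a ha
  have hlin : HasDerivAt (fun a => a * t₂) t₂ t₁ := by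
    simpa using (hasDerivAt_id t₁).mul_const t₂
  have hW := HasDerivAt.fun_sum (u := univ) fun k _ =>
    ((hasDerivAt_heatInt_time hc hM (0 + Pi.single k 2) hpos x).comp t₁ hlin).div_const 2
  rw [hev.deriv_eq, hu' hpos, lap_heatInt hc hM 0 hpos, lap_sum_heatInt hc hM _ hpos]
  refine (hW.mul (hasDerivAt_id t₁)).deriv.trans ?_
  simp only [Function.comp_def, id, ← Finset.sum_div, ← Finset.sum_mul]
  ring
end
end

section
/- Let f : ℝ^d → ℝ be bounded and measurable with all second order partial derivatives ∂²f/∂x_k∂x_l (1 ≤ k,l ≤ d) Hölder continuous with exponent α ∈ (0,1]. Set E(s,x) := ∫_{ℝ^d} f(y) K^{BS}(s;x,y) dy and, for fixed j ∈ {1,…,n}, ℰ^{(j)}(t,x) := ∫_{(0,∞)ⁿ} (∏_{i∈{1,…,n}\{j}} s_i²) E(s,x) ∏_{i=1}ⁿ K^{BM}(t_i;0,s_i) ds for t ∈ (0,∞)ⁿ, x ∈ ℝ^d. Then Δ_x² ℰ^{(j)}(t,x) is finite and Δ_x² ℰ^{(j)}(t,x) = ∫_{(0,∞)ⁿ} (∏_{i∈{1,…,n}\{j}}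 s_i²) Δ_x² E(s,x) ∏_{i=1}ⁿ K^{BM}(t_i;0,s_i) ds for every t ∈ (0,∞)ⁿ and x ∈ ℝ^d; if in addition all second partials ∂²f/∂x_k∂x_l are bounded, then (t,x) ↦ Δ_x² ℰ^{(j)}(t,x) is continuous on (0,∞)ⁿ × ℝ^d. -/
open MeasureTheory Real Filter Finset

noncomputable section

theorem pd_update {m : ℕ} (k : Fin m) (g : (Fin m → ℝ) → ℝ) (x : Fin m → ℝ) (a : ℝ) :
    pd k g (Function.update x k a) = deriv (fun h : ℝ => g (Function.update x k h)) a := by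
  simp [pd]

theorem pd_const_mul {m : ℕ} (k : Fin m) (c : ℝ) (g : (Fin m → ℝ) → ℝ) :
    pd k (fun x => c * g x) = fun x => c * pd k g x := by
  funext x
  simp [pd]

theorem lap_const_mul {m : ℕ} (c : ℝ) (g : (Fin m → ℝ) → ℝ) (x : Fin m → ℝ) :
    lap (fun x => c * g x) x = c * lap g x := by
  simp [lap, pd_const_mul, Finset.mul_sum]

theorem update_add_eq {m : ℕ} (k : Fin m) (x c : Fin m → ℝ) (h : ℝ) :
    Function.update x k h + c = Function.update (x + c) k (h + c k) := by
  ext i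
  by_cases hi : i = k
  · subst hi; simp
  · simp [hi]

theorem pd_comp_add {m : ℕ} (k : Fin m) (c : Fin m → ℝ) (g : (Fin m → ℝ) → ℝ) :
    pd k (fun x => g (x + c)) = fun x => pd k g (x + c) := by
  funext x
  simp only [pd, update_add_eq]
  rw [deriv_comp_add_const (f := fun h => g (Function.update (x + c) k h))]
  rfl

/-- The first two pure partial derivatives of `g` exist, and are bounded by `B₁` and `B₂`. -/
def HasBddPartials {m : ℕ} (g : (Fin m → ℝ) → ℝ) (B₁ B₂ : ℝ) : Prop :=
  ∀ k x, (DifferentiableAt ℝ (fun h : ℝ => g (Function.update x k h)) (x k) ∧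
      |pd k g x| ≤ B₁) ∧
    (DifferentiableAt ℝ (fun h : ℝ => pd k g (Function.update x k h)) (x k) ∧
      |pd k (pd k g) x| ≤ B₂)

theorem HasBddPartials.const_mul {m : ℕ} {g : (Fin m → ℝ) → ℝ} {B₁ B₂ : ℝ}
    (hg : HasBddPartials g B₁ B₂) (c : ℝ) :
    HasBddPartials (fun x => c * g x) (|c| * B₁) (|c| * B₂) := by
  intro k x
  obtain ⟨⟨h1, h2⟩, h3, h4⟩ := hg k x
  simp only [pd_const_mul, abs_mul]
  exact ⟨⟨h1.const_mul c, by gcongr⟩, h3.const_mul c, by gcongr⟩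

theorem differentiableAt_update_comp_add {m : ℕ} {k : Fin m} {c x : Fin m → ℝ}
    {g : (Fin m → ℝ) → ℝ}
    (h : DifferentiableAt ℝ (fun h : ℝ => g (Function.update (x + c) k h)) ((x + c) k)) :
    DifferentiableAt ℝ (fun h : ℝ => g (Function.update x k h + c)) (x k) := by
  simp only [update_add_eq]
  exact DifferentiableAt.comp (x k) (f := fun h : ℝ => h + c k) h (by fun_prop)

theorem HasBddPartials.comp_add {m : ℕ} {g : (Fin m → ℝ) → ℝ} {B₁ B₂ : ℝ}
    (hg : HasBddPartials g B₁ B₂) (c : Fin m → ℝ) :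
    HasBddPartials (fun x => g (x + c)) B₁ B₂ := by
  intro k x
  obtain ⟨⟨h1, h2⟩, h3, h4⟩ := hg k (x + c)
  simp only [pd_comp_add]
  exact ⟨⟨differentiableAt_update_comp_add h1, h2⟩, differentiableAt_update_comp_add h3, h4⟩

/-- Differentiation under the integral sign on the real line; measurability of the derivative is
automatic. -/
theorem hasDerivAt_integral_of_deriv_le {S : Type*} [MeasurableSpace S] {μ : Measure S}
    {F : S → ℝ → ℝ} {a : ℝ} {B : S → ℝ} (hF : ∀ h, Integrable (fun s => F s h) μ)
    (hB : Integrable B μ) (hd : ∀ᵐ s ∂μ, ∀ h, DifferentiableAt ℝ (F s) h)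
    (hle : ∀ᵐ s ∂μ, ∀ h ∈ Metric.ball a 1, |deriv (F s) h| ≤ B s) :
    Integrable (fun s => deriv (F s) a) μ ∧
      HasDerivAt (fun h => ∫ s, F s h ∂μ) (∫ s, deriv (F s) a ∂μ) a := by
  have hm : AEStronglyMeasurable (fun s => deriv (F s) a) μ := by
    have hlim : Tendsto (fun N : ℕ => a + 1 / ((N : ℝ) + 1)) atTop (nhdsWithin a {a}ᶜ) := by
      refine tendsto_nhdsWithin_iff.2 ⟨?_, Eventually.of_forall fun N => ?_⟩
      · simpa using (tendsto_one_div_add_atTop_nhds_zero_nat (𝕜 := ℝ)).const_add a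
      · have : (0 : ℝ) < 1 / ((N : ℝ) + 1) := by positivity
        simp only [Set.mem_compl_iff, Set.mem_singleton_iff]
        linarith
    refine aestronglyMeasurable_of_tendsto_ae atTop
      (f := fun N : ℕ => fun s => slope (F s) a (a + 1 / ((N : ℝ) + 1))) (fun N => ?_) ?_
    · simp only [slope_def_field]
      exact (((hF _).sub (hF _)).div_const _).aestronglyMeasurable
    · filter_upwards [hd] with s hs
      exact (hasDerivAt_iff_tendsto_slope.1 (hs a).hasDerivAt).comp hlim
  refine hasDerivAt_integral_of_dominated_loc_of_deriv_le (F := fun h s => F s h)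
    (F' := fun h s => deriv (F s) h) (bound := B) (Metric.ball_mem_nhds a one_pos)
    (Eventually.of_forall fun h => (hF h).aestronglyMeasurable) (hF a) hm ?_ hB ?_
  · filter_upwards [hle] with s hs h hh using hs h hh
  · filter_upwards [hd] with s hs h _ using (hs h).hasDerivAt

theorem integral_pd {S : Type*} [MeasurableSpace S] {μ : Measure S} {m : ℕ} (k : Fin m)
    {F : S → (Fin m → ℝ) → ℝ} {B : S → ℝ} (hF : ∀ x, Integrable (fun s => F s x) μ)
    (hB : Integrable B μ)
    (h : ∀ᵐ s ∂μ, ∀ x, DifferentiableAt ℝ (fun h : ℝ => F s (Function.update x k h)) (x k) ∧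
      |pd k (F s) x| ≤ B s) (x : Fin m → ℝ) :
    Integrable (fun s => pd k (F s) x) μ ∧
      DifferentiableAt ℝ (fun h : ℝ => ∫ s, F s (Function.update x k h) ∂μ) (x k) ∧
      pd k (fun x => ∫ s, F s x ∂μ) x = ∫ s, pd k (F s) x ∂μ := by
  obtain ⟨h1, h2⟩ := hasDerivAt_integral_of_deriv_le (a := x k)
    (F := fun s h => F s (Function.update x k h)) (fun h => hF _) hB
    (by
      filter_upwards [h] with s hs a
      simpa using (hs (Function.update x k a)).1)
    (by
      filter_upwards [h] with s hs a _
      rw [← pd_update]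
      exact (hs _).2)
  exact ⟨h1, h2.differentiableAt, h2.deriv⟩

theorem integral_pd_pd {S : Type*} [MeasurableSpace S] {μ : Measure S} {m : ℕ}
    {F : S → (Fin m → ℝ) → ℝ} {B₁ B₂ : S → ℝ} (hF : ∀ x, Integrable (fun s => F s x) μ)
    (hB₁ : Integrable B₁ μ) (hB₂ : Integrable B₂ μ)
    (h : ∀ᵐ s ∂μ, HasBddPartials (F s) (B₁ s) (B₂ s)) (k : Fin m) (x : Fin m → ℝ) :
    Integrable (fun s => pd k (pd k (F s)) x) μ ∧
      DifferentiableAt ℝ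
        (fun h : ℝ => pd k (fun x => ∫ s, F s x ∂μ) (Function.update x k h)) (x k) ∧
      pd k (pd k (fun x => ∫ s, F s x ∂μ)) x = ∫ s, pd k (pd k (F s)) x ∂μ := by
  have h1 := integral_pd k hF hB₁ (h.mono fun s hs x => (hs k x).1)
  have he : pd k (fun x => ∫ s, F s x ∂μ) = fun x => ∫ s, pd k (F s) x ∂μ :=
    funext fun x => (h1 x).2.2
  rw [he]
  exact integral_pd k (fun x => (h1 x).1) hB₂ (h.mono fun s hs x => (hs k x).2) x

theorem integral_hasBddPartials {S : Type*} [MeasurableSpace S] {μ : Measure S} {m : ℕ}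
    {F : S → (Fin m → ℝ) → ℝ} {B₁ B₂ : S → ℝ} (hF : ∀ x, Integrable (fun s => F s x) μ)
    (hB₁ : Integrable B₁ μ) (hB₂ : Integrable B₂ μ)
    (h : ∀ᵐ s ∂μ, HasBddPartials (F s) (B₁ s) (B₂ s)) :
    HasBddPartials (fun x => ∫ s, F s x ∂μ) (∫ s, B₁ s ∂μ) (∫ s, B₂ s ∂μ) := by
  intro k x
  have h1 := integral_pd k hF hB₁ (h.mono fun s hs x => (hs k x).1) x
  have h2 := integral_pd_pd hF hB₁ hB₂ h k x
  refine ⟨⟨h1.2.1, ?_⟩, h2.2.1, ?_⟩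
  · rw [h1.2.2, ← Real.norm_eq_abs]
    refine norm_integral_le_of_norm_le hB₁ (h.mono fun s hs => (hs k x).1.2)
  · rw [h2.2.2, ← Real.norm_eq_abs]
    refine norm_integral_le_of_norm_le hB₂ (h.mono fun s hs => (hs k x).2.2)

theorem integral_lap {S : Type*} [MeasurableSpace S] {μ : Measure S} {m : ℕ}
    {F : S → (Fin m → ℝ) → ℝ} {B₁ B₂ : S → ℝ} (hF : ∀ x, Integrable (fun s => F s x) μ)
    (hB₁ : Integrable B₁ μ) (hB₂ : Integrable B₂ μ)
    (h : ∀ᵐ s ∂μ, HasBddPartials (F s) (B₁ s) (B₂ s)) (x : Fin m → ℝ) :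
    Integrable (fun s => lap (F s) x) μ ∧
      lap (fun x => ∫ s, F s x ∂μ) x = ∫ s, lap (F s) x ∂μ := by
  have h2 := fun k => integral_pd_pd hF hB₁ hB₂ h k x
  refine ⟨integrable_finsetSum _ fun k _ => (h2 k).1, ?_⟩
  simp only [lap]
  rw [integral_finsetSum _ fun k _ => (h2 k).1]
  exact Finset.sum_congr rfl fun k _ => (h2 k).2.2

/-- The standard Gaussian density on `ℝ^d`. -/
def stdGaussian {d : ℕ} (z : Fin d → ℝ) : ℝ :=
  (2 * π) ^ (-(d : ℝ) / 2) * Real.exp (-(∑ k, z k ^ 2) / 2)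

/-- The heat semigroup on `ℝ^d` at time `p`. -/
def heat {d : ℕ} (p : ℝ) (g : (Fin d → ℝ) → ℝ) (x : Fin d → ℝ) : ℝ :=
  ∫ z, g (x + √p • z) * stdGaussian z

theorem stdGaussian_nonneg {d : ℕ} (z : Fin d → ℝ) : 0 ≤ stdGaussian z := by
  unfold stdGaussian; positivity

theorem continuous_stdGaussian {d : ℕ} : Continuous (stdGaussian (d := d)) := by
  unfold stdGaussian; fun_prop

theorem integrable_exp_mul_abs_sub_sq (c : ℝ) :
    Integrable (fun z : ℝ => Real.exp (c * |z| - z ^ 2 / 2)) := by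
  refine ((integrable_exp_neg_mul_sq (b := 1 / 4) (by norm_num)).const_mul
    (Real.exp (c ^ 2))).mono' (by fun_prop) (ae_of_all _ fun z => ?_)
  rw [Real.norm_eq_abs, abs_of_pos (Real.exp_pos _), ← Real.exp_add, Real.exp_le_exp]
  nlinarith [sq_nonneg (c - |z| / 2), sq_abs z]

theorem integrable_exp_mul_stdGaussian {d : ℕ} (c : ℝ) :
    Integrable (fun z : Fin d → ℝ => Real.exp (c * ∑ i, |z i|) * stdGaussian z) := by
  have h := (Integrable.fintype_prod (ι := Fin d) (μ := fun _ => volume)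
    fun _ => integrable_exp_mul_abs_sub_sq c).const_mul
    ((2 * π) ^ (-(d : ℝ) / 2))
  refine h.congr (ae_of_all _ fun z => ?_)
  simp only [stdGaussian, ← Real.exp_sum]
  rw [mul_left_comm, ← Real.exp_add]
  congr 2
  simp only [Finset.sum_sub_distrib, Finset.mul_sum, Finset.sum_div, neg_div]
  ring

theorem integrable_stdGaussian {d : ℕ} : Integrable (stdGaussian (d := d)) := by
  simpa using integrable_exp_mul_stdGaussian (d := d) 0

theorem abs_coord_le_sum {d : ℕ} (k : Fin d) (z : Fin d → ℝ) : |z k| ≤ ∑ i, |z i| :=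
  Finset.single_le_sum (f := fun i => |z i|) (fun _ _ => abs_nonneg _) (Finset.mem_univ k)

theorem norm_le_sum_abs {d : ℕ} (z : Fin d → ℝ) : ‖z‖ ≤ ∑ i, |z i| :=
  (pi_norm_le_iff_of_nonneg (Finset.sum_nonneg fun _ _ => abs_nonneg _)).2
    fun i => abs_coord_le_sum i z

theorem stdGaussian_sub_single {d : ℕ} (k : Fin d) (u : ℝ) (z : Fin d → ℝ) :
    stdGaussian (z - Pi.single k u) = stdGaussian z * Real.exp (u * z k - u ^ 2 / 2) := by
  have : ∑ i, (z - Pi.single k u : Fin d → ℝ) i ^ 2 = ∑ i, z i ^ 2 - 2 * (u * z k - u ^ 2 / 2) := by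
    rw [← Finset.add_sum_erase _ _ (Finset.mem_univ k),
      ← Finset.add_sum_erase _ (fun i => z i ^ 2) (Finset.mem_univ k)]
    have : ∑ i ∈ Finset.univ.erase k, (z - Pi.single k u : Fin d → ℝ) i ^ 2
        = ∑ i ∈ Finset.univ.erase k, z i ^ 2 :=
      Finset.sum_congr rfl fun i hi => by simp [Finset.ne_of_mem_erase hi]
    rw [this]
    simp
    ring
  unfold stdGaussian
  rw [this, mul_assoc, ← Real.exp_add]
  congr 2
  ring

theorem integral_comp_smul_eq_of_pos {d : ℕ} {c : ℝ} (hc : 0 < c) (F : (Fin d → ℝ) → ℝ) :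
    c ^ d * ∫ z, F (c • z) = ∫ z, F z := by
  rw [Measure.integral_comp_smul_of_nonneg volume F c (hR := hc.le)]
  simp [(pow_pos hc d).ne']

theorem integral_mul_Kbs {n d : ℕ} (f : (Fin d → ℝ) → ℝ) (s : Fin n → ℝ)
    (hs : 0 < ∏ i, s i) (x : Fin d → ℝ) :
    ∫ y, f y * Kbs n d s x y = heat (∏ i, s i) f x := by
  unfold heat Kbs
  generalize ∏ i, s i = p at *
  have hq : 0 < √p := Real.sqrt_pos.2 hs
  rw [← integral_add_left_eq_self _ x,
    ← integral_comp_smul_eq_of_pos (c := √p) hq]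
  rw [← integral_const_mul]
  refine integral_congr_ae (ae_of_all _ fun z => ?_)
  have h1 : (2 * π * p) ^ (-(d : ℝ) / 2) = (2 * π) ^ (-(d : ℝ) / 2) * (√p ^ d)⁻¹ := by
    rw [Real.mul_rpow (by positivity) hs.le, neg_div, Real.rpow_neg hs.le, Real.sqrt_eq_rpow,
      ← Real.rpow_natCast, ← Real.rpow_mul hs.le]
    ring_nf
  have h2 : -(∑ k, (x k - (x + √p • z) k) ^ 2) / (2 * p) = -(∑ k, z k ^ 2) / 2 := by
    have : ∑ k, (x k - (x + √p • z) k) ^ 2 = p * ∑ k, z k ^ 2 := by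
      rw [Finset.mul_sum]
      refine Finset.sum_congr rfl fun i _ => ?_
      simp [mul_pow, Real.sq_sqrt hs.le]
    rw [this]
    field_simp
  simp only [h1, h2, stdGaussian]
  field_simp

/-- Translating the Gaussian in the direction of the `k`-th coordinate. -/
theorem heat_update {d : ℕ} {p : ℝ} (hp : 0 < p) (g : (Fin d → ℝ) → ℝ) (k : Fin d)
    (x : Fin d → ℝ) (h : ℝ) :
    heat p g (Function.update x k h) = ∫ z, g (x + √p • z) * stdGaussian z *
      Real.exp ((h - x k) / √p * z k - ((h - x k) / √p) ^ 2 / 2) := by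
  have hq : √p ≠ 0 := (Real.sqrt_pos.2 hp).ne'
  unfold heat
  rw [← integral_sub_right_eq_self _ (Pi.single k ((h - x k) / √p))]
  refine integral_congr_ae (ae_of_all _ fun z => ?_)
  simp only [stdGaussian_sub_single, mul_assoc]
  congr 2
  ext i
  by_cases hi : i = k
  · subst hi; simp; field_simp; ring
  · simp [hi]

theorem add_sq_le_exp {a : ℝ} (ha : 0 ≤ a) : a ^ 2 + 1 ≤ 2 * Real.exp a := by
  nlinarith [Real.quadratic_le_exp_of_nonneg ha]

theorem le_exp_self (a : ℝ) : a ≤ Real.exp a := by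
  linarith [Real.add_one_le_exp a]

/-- The first two derivatives of an exponentially tilted Gaussian integral. -/
theorem hasDerivAt_tilted {d : ℕ} {G : (Fin d → ℝ) → ℝ} (hG : Measurable G) {M : ℝ}
    (hM : ∀ z, |G z| ≤ M) (k : Fin d) (u : ℝ) :
    HasDerivAt (fun u => ∫ z, G z * stdGaussian z * Real.exp (u * z k - u ^ 2 / 2))
      (∫ z, G z * stdGaussian z * ((z k - u) * Real.exp (u * z k - u ^ 2 / 2))) u ∧
    HasDerivAt (fun u => ∫ z, G z * stdGaussian z *
        ((z k - u) * Real.exp (u * z k - u ^ 2 / 2)))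
      (∫ z, G z * stdGaussian z *
        (((z k - u) ^ 2 - 1) * Real.exp (u * z k - u ^ 2 / 2))) u := by
  have hM0 : 0 ≤ M := (abs_nonneg _).trans (hM 0)
  have hd0 : ∀ (z : Fin d → ℝ) (v : ℝ),
      HasDerivAt (fun u => G z * stdGaussian z * Real.exp (u * z k - u ^ 2 / 2))
        (G z * stdGaussian z * ((z k - v) * Real.exp (v * z k - v ^ 2 / 2))) v := by
    intro z v
    have h1 : HasDerivAt (fun u : ℝ => u * z k - u ^ 2 / 2) (z k - v) v := by
      refine (((hasDerivAt_id' v).mul_const (z k)).sub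
        ((hasDerivAt_pow 2 v).div_const 2)).congr_deriv ?_
      simp
    exact (h1.exp.congr_deriv (mul_comm _ _)).const_mul _
  have hd1 : ∀ (z : Fin d → ℝ) (v : ℝ),
      HasDerivAt (fun u => G z * stdGaussian z * ((z k - u) * Real.exp (u * z k - u ^ 2 / 2)))
        (G z * stdGaussian z * (((z k - v) ^ 2 - 1) * Real.exp (v * z k - v ^ 2 / 2))) v := by
    intro z v
    have h1 : HasDerivAt (fun u : ℝ => u * z k - u ^ 2 / 2) (z k - v) v := by
      refine (((hasDerivAt_id' v).mul_const (z k)).sub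
        ((hasDerivAt_pow 2 v).div_const 2)).congr_deriv ?_
      simp
    refine ((((hasDerivAt_id v).const_sub (z k)).mul h1.exp).congr_deriv ?_).const_mul _
    simp only [id]
    ring
  have hexp : ∀ (z : Fin d → ℝ) (a v : ℝ), |v| ≤ a →
      Real.exp (v * z k - v ^ 2 / 2) ≤ Real.exp (a * ∑ i, |z i|) := by
    intro z a v hv
    rw [Real.exp_le_exp]
    have h1 : v * z k ≤ a * ∑ i, |z i| := by
      refine (le_abs_self _).trans ?_
      rw [abs_mul]
      exact mul_le_mul hv (abs_coord_le_sum k z) (abs_nonneg _) ((abs_nonneg _).trans hv)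
    nlinarith [sq_nonneg v]
  have hlin : ∀ (z : Fin d → ℝ) (a v : ℝ), |v| ≤ a → |z k - v| ≤ ∑ i, |z i| + a :=
    fun z a v hv => (abs_sub _ _).trans (add_le_add (abs_coord_le_sum k z) hv)
  have hb0 : ∀ (z : Fin d → ℝ) (a v : ℝ), |v| ≤ a →
      |G z * stdGaussian z * Real.exp (v * z k - v ^ 2 / 2)|
        ≤ M * (Real.exp (a * ∑ i, |z i|) * stdGaussian z) := by
    intro z a v hv
    rw [abs_mul, abs_mul, abs_of_nonneg (stdGaussian_nonneg z), abs_of_pos (Real.exp_pos _),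
      mul_assoc, mul_comm (stdGaussian z)]
    exact mul_le_mul (hM z) (mul_le_mul_of_nonneg_right (hexp z a v hv) (stdGaussian_nonneg z))
      (by have := stdGaussian_nonneg z; positivity) hM0
  have hb1 : ∀ (z : Fin d → ℝ) (a v : ℝ), |v| ≤ a →
      |G z * stdGaussian z * ((z k - v) * Real.exp (v * z k - v ^ 2 / 2))|
        ≤ M * Real.exp a * (Real.exp ((a + 1) * ∑ i, |z i|) * stdGaussian z) := by
    intro z a v hv
    rw [abs_mul, abs_mul, abs_mul, abs_of_nonneg (stdGaussian_nonneg z),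
      abs_of_pos (Real.exp_pos _)]
    have h1 : |z k - v| * Real.exp (v * z k - v ^ 2 / 2)
        ≤ Real.exp (∑ i, |z i| + a) * Real.exp (a * ∑ i, |z i|) :=
      mul_le_mul ((hlin z a v hv).trans (le_exp_self _)) (hexp z a v hv) (Real.exp_pos _).le
        (Real.exp_pos _).le
    calc _ ≤ M * stdGaussian z * (Real.exp (∑ i, |z i| + a) * Real.exp (a * ∑ i, |z i|)) :=
          mul_le_mul (mul_le_mul_of_nonneg_right (hM z) (stdGaussian_nonneg z)) h1
            (by positivity) (mul_nonneg hM0 (stdGaussian_nonneg z))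
      _ = _ := by
          rw [add_one_mul, Real.exp_add, Real.exp_add]
          ring
  have hb2 : ∀ (z : Fin d → ℝ) (a v : ℝ), |v| ≤ a →
      |G z * stdGaussian z * (((z k - v) ^ 2 - 1) * Real.exp (v * z k - v ^ 2 / 2))|
        ≤ M * 2 * Real.exp a * (Real.exp ((a + 1) * ∑ i, |z i|) * stdGaussian z) := by
    intro z a v hv
    rw [abs_mul, abs_mul, abs_mul, abs_of_nonneg (stdGaussian_nonneg z),
      abs_of_pos (Real.exp_pos _)]
    have h0 : |(z k - v) ^ 2 - 1| ≤ 2 * Real.exp (∑ i, |z i| + a) := by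
      calc |(z k - v) ^ 2 - 1| ≤ |z k - v| ^ 2 + 1 := by
            rw [sq_abs, abs_le]
            constructor <;> nlinarith [sq_nonneg (z k - v)]
        _ ≤ 2 * Real.exp |z k - v| := add_sq_le_exp (abs_nonneg _)
        _ ≤ _ := by
            have := Real.exp_le_exp.2 (hlin z a v hv)
            linarith
    have h1 : |(z k - v) ^ 2 - 1| * Real.exp (v * z k - v ^ 2 / 2)
        ≤ 2 * Real.exp (∑ i, |z i| + a) * Real.exp (a * ∑ i, |z i|) :=
      mul_le_mul h0 (hexp z a v hv) (Real.exp_pos _).le (by positivity)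
    calc _ ≤ M * stdGaussian z *
          (2 * Real.exp (∑ i, |z i| + a) * Real.exp (a * ∑ i, |z i|)) :=
          mul_le_mul (mul_le_mul_of_nonneg_right (hM z) (stdGaussian_nonneg z)) h1
            (by positivity) (mul_nonneg hM0 (stdGaussian_nonneg z))
      _ = _ := by
          rw [add_one_mul, Real.exp_add, Real.exp_add]
          ring
  have hφ : Measurable (stdGaussian (d := d)) := continuous_stdGaussian.measurable
  have hball : ∀ v ∈ Metric.ball u 1, |v| ≤ |u| + 1 := by
    intro v hv
    rw [Metric.mem_ball, Real.dist_eq] at hv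
    linarith [abs_sub_abs_le_abs_sub v u]
  constructor
  · have := (hasDerivAt_integral_of_deriv_le (a := u)
      (F := fun (z : Fin d → ℝ) u => G z * stdGaussian z * Real.exp (u * z k - u ^ 2 / 2))
      (fun v => ((integrable_exp_mul_stdGaussian |v|).const_mul M).mono'
        (by fun_prop) (ae_of_all _ fun z => hb0 z _ v le_rfl))
      ((integrable_exp_mul_stdGaussian (|u| + 1 + 1)).const_mul (M * Real.exp (|u| + 1)))
      (ae_of_all _ fun z v => (hd0 z v).differentiableAt)
      (ae_of_all _ fun z v hv => by
        rw [(hd0 z v).deriv]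
        exact hb1 z _ v (hball v hv))).2
    simpa only [(hd0 _ u).deriv] using this
  · have := (hasDerivAt_integral_of_deriv_le (a := u)
      (F := fun (z : Fin d → ℝ) u => G z * stdGaussian z *
        ((z k - u) * Real.exp (u * z k - u ^ 2 / 2)))
      (fun v => ((integrable_exp_mul_stdGaussian (|v| + 1)).const_mul
        (M * Real.exp |v|)).mono'
        (by fun_prop) (ae_of_all _ fun z => hb1 z _ v le_rfl))
      ((integrable_exp_mul_stdGaussian (|u| + 1 + 1)).const_mul (M * 2 * Real.exp (|u| + 1)))
      (ae_of_all _ fun z v => (hd1 z v).differentiableAt)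
      (ae_of_all _ fun z v hv => by
        rw [(hd1 z v).deriv]
        exact hb2 z _ v (hball v hv))).2
    simpa only [(hd1 _ u).deriv] using this

/-- The Hermite-type formulas for the first two partial derivatives of the heat semigroup. -/
theorem pd_heat {d : ℕ} {p : ℝ} (hp : 0 < p) {g : (Fin d → ℝ) → ℝ} (hg : Measurable g) {M : ℝ}
    (hM : ∀ z, |g z| ≤ M) (k : Fin d) (x : Fin d → ℝ) :
    (DifferentiableAt ℝ (fun h : ℝ => heat p g (Function.update x k h)) (x k) ∧
      pd k (heat p g) x = (√p)⁻¹ * ∫ z, g (x + √p • z) * stdGaussian z * z k) ∧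
    (DifferentiableAt ℝ (fun h : ℝ => pd k (heat p g) (Function.update x k h)) (x k) ∧
      pd k (pd k (heat p g)) x
        = p⁻¹ * ∫ z, g (x + √p • z) * stdGaussian z * (z k ^ 2 - 1)) := by
  have hq : 0 < √p := Real.sqrt_pos.2 hp
  have hG : Measurable fun z : Fin d → ℝ => g (x + √p • z) := by fun_prop
  have ht := hasDerivAt_tilted hG (fun z => hM _) k
  have hin : ∀ h : ℝ, HasDerivAt (fun h => (h - x k) / √p) (1 / √p) h := fun h =>
    ((hasDerivAt_id' h).sub_const (x k)).div_const _
  have hv : ∀ h : ℝ, HasDerivAt (fun h : ℝ => heat p g (Function.update x k h))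
      ((∫ z, g (x + √p • z) * stdGaussian z * ((z k - (h - x k) / √p) *
        Real.exp ((h - x k) / √p * z k - ((h - x k) / √p) ^ 2 / 2))) * (1 / √p)) h := by
    intro h
    simp only [heat_update hp]
    exact HasDerivAt.comp h (h₂ := fun u => ∫ z, g (x + √p • z) * stdGaussian z *
      Real.exp (u * z k - u ^ 2 / 2)) (ht _).1 (hin h)
  have hv2 : HasDerivAt (fun h : ℝ => pd k (heat p g) (Function.update x k h))
      ((∫ z, g (x + √p • z) * stdGaussian z * (((z k - (x k - x k) / √p) ^ 2 - 1) *
        Real.exp ((x k - x k) / √p * z k - ((x k - x k) / √p) ^ 2 / 2))) * (1 / √p)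
        * (1 / √p)) (x k) := by
    simp only [pd_update, (hv _).deriv]
    exact (HasDerivAt.comp (x k) (h₂ := fun u => ∫ z, g (x + √p • z) * stdGaussian z *
      ((z k - u) * Real.exp (u * z k - u ^ 2 / 2))) (ht _).2 (hin _)).mul_const _
  refine ⟨⟨(hv _).differentiableAt, ?_⟩, hv2.differentiableAt, ?_⟩
  · rw [pd, (hv _).deriv, mul_comm]
    simp
  · have hpq : 1 / √p * (1 / √p) = p⁻¹ := by
      rw [div_mul_div_comm, Real.mul_self_sqrt hp.le, one_mul, one_div]
    rw [pd, hv2.deriv, mul_assoc, mul_comm, hpq]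
    simp

theorem integral_stdGaussian_mul_sq_sub_one {d : ℕ} (k : Fin d) :
    ∫ z : Fin d → ℝ, stdGaussian z * (z k ^ 2 - 1) = 0 := by
  have h := (pd_heat (p := 1) one_pos (g := fun _ : Fin d → ℝ => (1 : ℝ)) measurable_const
    (M := 1) (by simp) k 0).2.2
  simpa [heat, pd] using h.symm

/-- An exponential moment of the standard Gaussian. -/
def gaussianMoment (d : ℕ) : ℝ :=
  ∫ z : Fin d → ℝ, Real.exp (2 * ∑ i, |z i|) * stdGaussian z

theorem abs_integral_mul_stdGaussian_le {d : ℕ} {G : (Fin d → ℝ) → ℝ} {C : ℝ}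
    (h : ∀ z, |G z| ≤ C * Real.exp (2 * ∑ i, |z i|)) :
    |∫ z, G z * stdGaussian z| ≤ C * gaussianMoment d := by
  rw [gaussianMoment, ← integral_const_mul, ← Real.norm_eq_abs]
  refine norm_integral_le_of_norm_le ((integrable_exp_mul_stdGaussian 2).const_mul C)
    (ae_of_all _ fun z => ?_)
  rw [Real.norm_eq_abs, abs_mul, abs_of_nonneg (stdGaussian_nonneg z), ← mul_assoc]
  exact mul_le_mul_of_nonneg_right (h z) (stdGaussian_nonneg z)

theorem sum_abs_nonneg {d : ℕ} (z : Fin d → ℝ) : 0 ≤ ∑ i, |z i| :=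
  Finset.sum_nonneg fun _ _ => abs_nonneg _

theorem abs_sq_sub_one_le {d : ℕ} (k : Fin d) (z : Fin d → ℝ) :
    |z k ^ 2 - 1| ≤ 2 * Real.exp (∑ i, |z i|) := by
  calc |z k ^ 2 - 1| ≤ |z k| ^ 2 + 1 := by
        rw [sq_abs, abs_le]
        constructor <;> nlinarith [sq_nonneg (z k)]
    _ ≤ 2 * Real.exp |z k| := add_sq_le_exp (abs_nonneg _)
    _ ≤ _ := by
        have := Real.exp_le_exp.2 (abs_coord_le_sum k z)
        linarith

theorem abs_heat_le {d : ℕ} {p : ℝ} {g : (Fin d → ℝ) → ℝ} {M : ℝ} (hM : ∀ z, |g z| ≤ M)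
    (x : Fin d → ℝ) : |heat p g x| ≤ M * gaussianMoment d := by
  refine abs_integral_mul_stdGaussian_le fun z => (hM _).trans ?_
  exact le_mul_of_one_le_right ((abs_nonneg _).trans (hM 0))
    (Real.one_le_exp (mul_nonneg zero_le_two (sum_abs_nonneg z)))

theorem abs_pd_heat_le {d : ℕ} {p : ℝ} (hp : 0 < p) {g : (Fin d → ℝ) → ℝ} (hg : Measurable g)
    {M : ℝ} (hM : ∀ z, |g z| ≤ M) (k : Fin d) (x : Fin d → ℝ) :
    |pd k (heat p g) x| ≤ (√p)⁻¹ * (M * gaussianMoment d) := by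
  rw [(pd_heat hp hg hM k x).1.2, abs_mul, abs_of_nonneg (by positivity)]
  simp only [mul_right_comm]
  refine mul_le_mul_of_nonneg_left (abs_integral_mul_stdGaussian_le fun z => ?_) (by positivity)
  rw [abs_mul]
  refine mul_le_mul (hM _) ?_ (abs_nonneg _) ((abs_nonneg _).trans (hM 0))
  refine (abs_coord_le_sum k z).trans ((le_exp_self _).trans (Real.exp_le_exp.2 ?_))
  linarith [sum_abs_nonneg z]

theorem integrable_mul_stdGaussian_mul_sq_sub_one {d : ℕ} {G : (Fin d → ℝ) → ℝ}
    (hG : Measurable G) {M : ℝ} (hM : ∀ z, |G z| ≤ M) (k : Fin d) :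
    Integrable fun z => G z * stdGaussian z * (z k ^ 2 - 1) := by
  have hφ : Measurable (stdGaussian (d := d)) := continuous_stdGaussian.measurable
  refine ((integrable_exp_mul_stdGaussian 1).const_mul (M * 2)).mono' (by fun_prop)
    (ae_of_all _ fun z => ?_)
  rw [mul_right_comm, Real.norm_eq_abs, abs_mul, abs_mul, abs_of_nonneg (stdGaussian_nonneg z),
    ← mul_assoc, one_mul, mul_assoc M]
  refine mul_le_mul_of_nonneg_right ?_ (stdGaussian_nonneg z)
  exact mul_le_mul (hM _) (abs_sq_sub_one_le k z) (abs_nonneg _) ((abs_nonneg _).trans (hM 0))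

theorem abs_pd_pd_heat_le {d : ℕ} {p : ℝ} (hp : 0 < p) {g : (Fin d → ℝ) → ℝ}
    (hg : Measurable g) {M : ℝ} (hM : ∀ z, |g z| ≤ M) {α L : ℝ} (hα : 0 < α) (hα1 : α ≤ 1)
    (hL : ∀ x y, |g x - g y| ≤ L * dist x y ^ α) (hL0 : 0 ≤ L) (k : Fin d) (x : Fin d → ℝ) :
    |pd k (pd k (heat p g)) x| ≤ p ^ (α / 2 - 1) * (L * 2 * gaussianMoment d) := by
  have hG : Measurable fun z : Fin d → ℝ => g (x + √p • z) := by fun_prop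
  have h1 : ∫ z, g (x + √p • z) * stdGaussian z * (z k ^ 2 - 1)
      = ∫ z, (g (x + √p • z) - g x) * (z k ^ 2 - 1) * stdGaussian z := by
    have h2 : ∫ z : Fin d → ℝ, g x * stdGaussian z * (z k ^ 2 - 1) = 0 := by
      simp only [mul_assoc, integral_const_mul, integral_stdGaussian_mul_sq_sub_one, mul_zero]
    rw [← sub_zero (∫ z, g (x + √p • z) * stdGaussian z * (z k ^ 2 - 1)), ← h2,
      ← integral_sub (integrable_mul_stdGaussian_mul_sq_sub_one hG (fun z => hM _) k)
        (integrable_mul_stdGaussian_mul_sq_sub_one measurable_const (fun z => hM x) k)]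
    exact integral_congr_ae (ae_of_all _ fun z => by ring)
  have h3 : p ^ (α / 2 - 1) = p⁻¹ * √p ^ α := by
    rw [Real.sqrt_eq_rpow, ← Real.rpow_mul hp.le, ← Real.rpow_neg_one, ← Real.rpow_add hp]
    ring_nf
  rw [(pd_heat hp hg hM k x).2.2, abs_mul, abs_of_nonneg (by positivity), h1, h3, mul_assoc]
  refine mul_le_mul_of_nonneg_left ?_ (by positivity)
  rw [← mul_assoc]
  refine abs_integral_mul_stdGaussian_le fun z => ?_
  rw [abs_mul]
  have h4 : |g (x + √p • z) - g x| ≤ √p ^ α * L * Real.exp (∑ i, |z i|) := by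
    have h5 : ‖z‖ ^ α ≤ Real.exp (∑ i, |z i|) := by
      calc ‖z‖ ^ α ≤ (1 + ‖z‖) ^ α := by
            exact Real.rpow_le_rpow (norm_nonneg _) (by linarith) hα.le
        _ ≤ (1 + ‖z‖) ^ (1 : ℝ) :=
            Real.rpow_le_rpow_of_exponent_le (by linarith [norm_nonneg z]) hα1
        _ ≤ ∑ i, |z i| + 1 := by
            rw [Real.rpow_one]
            linarith [norm_le_sum_abs z]
        _ ≤ _ := Real.add_one_le_exp _
    calc |g (x + √p • z) - g x| ≤ L * dist (x + √p • z) x ^ α := hL _ _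
      _ = √p ^ α * L * ‖z‖ ^ α := by
          rw [dist_eq_norm, add_sub_cancel_left, norm_smul, Real.norm_of_nonneg (by positivity),
            Real.mul_rpow (by positivity) (by positivity)]
          ring
      _ ≤ _ := mul_le_mul_of_nonneg_left h5 (by positivity)
  calc _ ≤ √p ^ α * L * Real.exp (∑ i, |z i|) * (2 * Real.exp (∑ i, |z i|)) :=
        mul_le_mul h4 (abs_sq_sub_one_le k z) (abs_nonneg _) (by positivity)
    _ = _ := by
        rw [two_mul (∑ i, |z i|), Real.exp_add]
        ring

theorem hasBddPartials_heat {d : ℕ} {p : ℝ} (hp : 0 < p) {g : (Fin d → ℝ) → ℝ}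
    (hg : Measurable g) {M : ℝ} (hM : ∀ z, |g z| ≤ M) {α L : ℝ} (hα : 0 < α) (hα1 : α ≤ 1)
    (hL : ∀ x y, |g x - g y| ≤ L * dist x y ^ α) (hL0 : 0 ≤ L) :
    HasBddPartials (heat p g) ((√p)⁻¹ * (M * gaussianMoment d))
      (p ^ (α / 2 - 1) * (L * 2 * gaussianMoment d)) := fun k x =>
  ⟨⟨(pd_heat hp hg hM k x).1.1, abs_pd_heat_le hp hg hM k x⟩, (pd_heat hp hg hM k x).2.1,
    abs_pd_pd_heat_le hp hg hM hα hα1 hL hL0 k x⟩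

theorem continuous_lap_heat {d : ℕ} {p : ℝ} (hp : 0 < p) {g : (Fin d → ℝ) → ℝ}
    (hg : Continuous g) {M : ℝ} (hM : ∀ z, |g z| ≤ M) : Continuous (lap (heat p g)) := by
  have hφ : Continuous (stdGaussian (d := d)) := continuous_stdGaussian
  refine continuous_finsetSum _ fun k _ => ?_
  rw [funext fun x => (pd_heat hp hg.measurable hM k x).2.2]
  refine continuous_const.mul (continuous_of_dominated (fun x => ?_) (fun x => ae_of_all _ fun z => ?_)
    ((integrable_mul_stdGaussian_mul_sq_sub_one (d := d) (measurable_const (a := M))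
      (fun _ => le_rfl) k).norm) (ae_of_all _ fun z => by fun_prop))
  · exact Continuous.aestronglyMeasurable (by fun_prop)
  · rw [norm_mul, norm_mul, norm_mul, norm_mul]
    gcongr
    exact (hM _).trans (le_abs_self M)

theorem integrable_bdd_mul_stdGaussian {d : ℕ} {G : (Fin d → ℝ) → ℝ}
    (hG : Measurable G) {M : ℝ} (hM : ∀ z, |G z| ≤ M) :
    Integrable fun z => G z * stdGaussian z := by
  refine (integrable_stdGaussian.const_mul M).mono'
    (hG.mul continuous_stdGaussian.measurable).aestronglyMeasurable (ae_of_all _ fun z => ?_)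
  rw [Real.norm_eq_abs, abs_mul, abs_of_nonneg (stdGaussian_nonneg z)]
  exact mul_le_mul_of_nonneg_right (hM z) (stdGaussian_nonneg z)

/-- The heat semigroup commutes with the Laplacian on functions with bounded partials. -/
theorem heat_of_hasBddPartials {d : ℕ} (p : ℝ) {f : (Fin d → ℝ) → ℝ} (hf : Measurable f)
    {M B₁ B₂ : ℝ} (hM : ∀ z, |f z| ≤ M) (h : HasBddPartials f B₁ B₂) :
    HasBddPartials (heat p f) (B₁ * ∫ z : Fin d → ℝ, stdGaussian z)
      (B₂ * ∫ z : Fin d → ℝ, stdGaussian z) ∧ lap (heat p f) = heat p (lap f) := by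
  have hF : ∀ x, Integrable fun z => f (x + √p • z) * stdGaussian z := fun x =>
    integrable_bdd_mul_stdGaussian (hf.comp (by fun_prop)) fun z => hM _
  have hI : ∀ B : ℝ, Integrable fun z : Fin d → ℝ => B * stdGaussian z := fun B =>
    integrable_stdGaussian.const_mul B
  have hp : ∀ z, HasBddPartials (fun x => f (x + √p • z) * stdGaussian z)
      (B₁ * stdGaussian z) (B₂ * stdGaussian z) := by
    intro z
    have := (h.comp_add (√p • z)).const_mul (stdGaussian z)
    rw [abs_of_nonneg (stdGaussian_nonneg z)] at this
    simpa only [mul_comm] using this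
  constructor
  · simp only [← integral_const_mul]
    exact integral_hasBddPartials hF (hI B₁) (hI B₂) (ae_of_all _ hp)
  · funext x
    have := (integral_lap hF (hI B₁) (hI B₂) (ae_of_all _ hp) x).2
    refine this.trans (integral_congr_ae (ae_of_all _ fun z => ?_))
    simp only [mul_comm _ (stdGaussian z), lap_const_mul]
    simp only [lap, pd_comp_add]

/-- The density in `s` of `ℰ^{(j)}` with respect to Lebesgue measure, without the factor `E`. -/
def btWeight {n : ℕ} (j : Fin n) (t s : Fin n → ℝ) : ℝ :=
  (∏ i ∈ Finset.univ.erase j, s i ^ 2) * ∏ i, Kbm (t i) (s i)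

theorem Kbm_nonneg {t : ℝ} (ht : 0 < t) (s : ℝ) : 0 ≤ Kbm t s := by
  unfold Kbm; positivity

theorem btWeight_nonneg {n : ℕ} (j : Fin n) {t : Fin n → ℝ} (ht : ∀ i, 0 < t i)
    (s : Fin n → ℝ) : 0 ≤ btWeight j t s :=
  mul_nonneg (Finset.prod_nonneg fun _ _ => sq_nonneg _)
    (Finset.prod_nonneg fun i _ => Kbm_nonneg (ht i) _)

theorem measurableSet_orthant (n : ℕ) : MeasurableSet {s : Fin n → ℝ | ∀ i, 0 < s i} := by
  simp only [Set.ofPred_forall]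
  exact MeasurableSet.iInter fun i => measurableSet_lt measurable_const (measurable_pi_apply i)

theorem integrableOn_rpow_mul_Kbm {t : ℝ} (ht : 0 < t) {a : ℝ} (ha : -1 < a) :
    IntegrableOn (fun s => s ^ a * Kbm t s) (Set.Ioi 0) := by
  refine ((integrableOn_rpow_mul_exp_neg_mul_sq (b := 1 / (2 * t)) (by positivity)
    ha).const_mul ((2 * π * t) ^ (-(1 : ℝ) / 2))).congr (ae_of_all _ fun s => ?_)
  simp only [Kbm]
  rw [mul_left_comm]
  congr 3
  ring

theorem integrableOn_btWeight_mul_rpow {n : ℕ} (j : Fin n) {t : Fin n → ℝ} (ht : ∀ i, 0 < t i)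
    {a : ℝ} (ha : -1 < a) :
    IntegrableOn (fun s => btWeight j t s * (∏ i, s i) ^ a) {s : Fin n → ℝ | ∀ i, 0 < s i} := by
  have h1 : ∀ i, IntegrableOn
      (fun s : ℝ => (if i = j then 1 else s ^ 2) * (s ^ a * Kbm (t i) s)) (Set.Ioi 0) := by
    intro i
    split_ifs
    · simpa using integrableOn_rpow_mul_Kbm (ht i) ha
    · refine (integrableOn_rpow_mul_Kbm (ht i) (a := a + 2) (by linarith)).congr_fun
        (fun s hs => ?_) measurableSet_Ioi
      simp only
      rw [Real.rpow_add hs, Real.rpow_two]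
      ring
  have h2 := Integrable.fintype_prod h1
  rw [← Measure.restrict_pi_pi] at h2
  have hS : (Set.univ.pi fun _ : Fin n => Set.Ioi (0 : ℝ)) = {s | ∀ i, 0 < s i} := by
    ext s; simp
  rw [hS] at h2
  refine IntegrableOn.congr_fun h2 (fun s hs => ?_) (measurableSet_orthant n)
  simp only [btWeight, Finset.prod_mul_distrib]
  rw [← Finset.mul_prod_erase _ (fun i => if i = j then (1 : ℝ) else s i ^ 2)
    (Finset.mem_univ j), Real.finsetProd_rpow _ _ fun i _ => (hs i).le,
    Finset.prod_congr rfl fun i hi => if_neg (Finset.ne_of_mem_erase hi)]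
  simp only [if_true]
  ring

theorem measurable_btWeight {n : ℕ} (j : Fin n) (t : Fin n → ℝ) :
    Measurable (btWeight j t) := by
  unfold btWeight Kbm
  fun_prop

theorem measurable_heat_prod {n d : ℕ} {g : (Fin d → ℝ) → ℝ} (hg : Measurable g)
    (x : Fin d → ℝ) : Measurable fun s : Fin n → ℝ => heat (∏ i, s i) g x := by
  have hφ : Measurable (stdGaussian (d := d)) := continuous_stdGaussian.measurable
  refine (StronglyMeasurable.integral_prod_right
    (f := fun (s : Fin n → ℝ) z => g (x + √(∏ i, s i) • z) * stdGaussian z) ?_).measurable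
  refine Measurable.stronglyMeasurable ?_
  simp only [Function.uncurry_def]
  refine Measurable.mul (hg.comp ?_) (hφ.comp measurable_snd)
  have : Continuous fun a : (Fin n → ℝ) × (Fin d → ℝ) => x + √(∏ i, a.1 i) • a.2 := by fun_prop
  exact this.measurable

theorem Kbm_le_two_mul {t t₀ : ℝ} (ht0 : 0 < t₀) (h1 : t₀ / 2 < t) (h2 : t < 2 * t₀) (s : ℝ) :
    Kbm t s ≤ 2 * Kbm (2 * t₀) s := by
  have ht : 0 < t := by linarith
  unfold Kbm
  rw [← mul_assoc]
  refine mul_le_mul ?_ (Real.exp_le_exp.2 ?_) (Real.exp_pos _).le (by positivity)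
  · have h3 : (2 * π * (2 * t₀)) ^ (-(1 : ℝ) / 2) = (1 / 2) * (π * t₀) ^ (-(1 : ℝ) / 2) := by
      rw [show 2 * π * (2 * t₀) = 2 ^ (2 : ℝ) * (π * t₀) by rw [Real.rpow_two]; ring,
        Real.mul_rpow (by positivity) (by positivity), ← Real.rpow_mul (by norm_num)]
      congr 1
      rw [show (2 : ℝ) * (-1 / 2) = -1 by ring, Real.rpow_neg_one]
      norm_num
    rw [h3, ← mul_assoc, mul_one_div_cancel two_ne_zero, one_mul]
    refine Real.rpow_le_rpow_of_nonpos (by positivity) ?_ (by norm_num)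
    nlinarith [Real.pi_pos]
  · rw [neg_div, neg_div, neg_le_neg_iff]
    gcongr

theorem btWeight_le {n : ℕ} (j : Fin n) {t t₀ : Fin n → ℝ} (ht0 : ∀ i, 0 < t₀ i)
    (h1 : ∀ i, t₀ i / 2 < t i) (h2 : ∀ i, t i < 2 * t₀ i) (s : Fin n → ℝ) :
    btWeight j t s ≤ 2 ^ n * btWeight j (fun i => 2 * t₀ i) s := by
  unfold btWeight
  rw [mul_left_comm]
  refine mul_le_mul_of_nonneg_left ?_ (Finset.prod_nonneg fun _ _ => sq_nonneg _)
  calc ∏ i, Kbm (t i) (s i) ≤ ∏ i, 2 * Kbm (2 * t₀ i) (s i) :=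
        Finset.prod_le_prod (fun i _ => Kbm_nonneg (by linarith [ht0 i, h1 i]) _)
          fun i _ => Kbm_le_two_mul (ht0 i) (h1 i) (h2 i) _
    _ = _ := by simp [Finset.prod_mul_distrib]

theorem continuousAt_btWeight {n : ℕ} (j : Fin n) {t₀ : Fin n → ℝ} (ht0 : ∀ i, 0 < t₀ i)
    (s : Fin n → ℝ) : ContinuousAt (fun t => btWeight j t s) t₀ := by
  unfold btWeight Kbm
  refine continuousAt_const.mul (tendsto_finsetProd _ fun i _ => ?_)
  have h := ht0 i
  have hc : ContinuousAt (fun t : Fin n → ℝ => t i) t₀ := (continuous_apply i).continuousAt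
  refine ContinuousAt.mul (ContinuousAt.rpow_const (continuousAt_const.mul hc) (Or.inl (by positivity))) ?_
  exact (ContinuousAt.div continuousAt_const (continuousAt_const.mul hc)
    (mul_pos two_pos h).ne').rexp

theorem abs_le_of_holder_deriv_deriv {u : ℝ → ℝ} {M : ℝ} (hM : ∀ x, |u x| ≤ M)
    (h1 : Differentiable ℝ u) (h2 : Differentiable ℝ (deriv u)) {α L : ℝ} (hα : 0 < α)
    (hα1 : α ≤ 1) (hL0 : 0 ≤ L)
    (hL : ∀ x y, |deriv (deriv u) x - deriv (deriv u) y| ≤ L * |x - y| ^ α) (x : ℝ) :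
    |deriv u x| ≤ 6 * M + 3 * L ∧ |deriv (deriv u) x| ≤ 4 * M + 3 * L := by
  have hu : ∀ y, ∃ c ∈ Set.Ioo y (y + 1), |deriv u c| ≤ 2 * M := by
    intro y
    obtain ⟨c, hc, he⟩ := exists_deriv_eq_slope u (by linarith : y < y + 1)
      h1.continuous.continuousOn h1.differentiableOn
    refine ⟨c, hc, ?_⟩
    rw [he, add_sub_cancel_left, div_one]
    exact (abs_sub _ _).trans (by linarith [hM y, hM (y + 1)])
  have h2b : ∀ x, |deriv (deriv u) x| ≤ 4 * M + 3 * L := by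
    intro x
    obtain ⟨a, ha, hab⟩ := hu x
    obtain ⟨b, hb, hbb⟩ := hu (x + 2)
    have hlt : a < b := by linarith [ha.2, hb.1]
    obtain ⟨c, hc, he⟩ := exists_deriv_eq_slope (deriv u) hlt
      h2.continuous.continuousOn h2.differentiableOn
    have hcb : |deriv (deriv u) c| ≤ 4 * M := by
      rw [he, abs_div]
      refine div_le_of_le_mul₀ (abs_nonneg _) (by linarith [(abs_nonneg _).trans (hM 0)]) ?_
      rw [abs_of_pos (sub_pos.2 hlt)]
      have h3 := (abs_sub (deriv u b) (deriv u a))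
      nlinarith [(abs_nonneg _).trans (hM 0), ha.2, hb.1]
    have h4 : |x - c| ^ α ≤ 3 := by
      have h5 : |x - c| ≤ 3 := by
        rw [abs_le]
        constructor <;> linarith [ha.1, ha.2, hb.2, hc.1, hc.2]
      calc |x - c| ^ α ≤ 3 ^ α := Real.rpow_le_rpow (abs_nonneg _) h5 hα.le
        _ ≤ 3 ^ (1 : ℝ) := Real.rpow_le_rpow_of_exponent_le (by norm_num) hα1
        _ = 3 := Real.rpow_one 3
    have h6 := hL x c
    have h7 := abs_sub_abs_le_abs_sub (deriv (deriv u) x) (deriv (deriv u) c)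
    nlinarith
  refine ⟨?_, h2b x⟩
  obtain ⟨a, ha, hab⟩ := hu x
  obtain ⟨c, hc, he⟩ := exists_deriv_eq_slope (deriv u) ha.1
    h2.continuous.continuousOn h2.differentiableOn
  have h3 : deriv u a - deriv u x = deriv (deriv u) c * (a - x) := by
    rw [he]
    have := (sub_pos.2 ha.1).ne'
    field_simp
  have h4 : |deriv u a - deriv u x| ≤ 4 * M + 3 * L := by
    rw [h3, abs_mul]
    have := h2b c
    rw [abs_of_pos (sub_pos.2 ha.1)]
    nlinarith [abs_nonneg (deriv (deriv u) c), ha.2, ha.1]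
  have h5 := abs_sub_abs_le_abs_sub (deriv u x) (deriv u a)
  rw [abs_sub_comm] at h5
  linarith

theorem hasBddPartials_of_holder {d : ℕ} {f : (Fin d → ℝ) → ℝ} {M : ℝ} (hM : ∀ y, |f y| ≤ M)
    {α L : ℝ} (hα : 0 < α) (hα1 : α ≤ 1) (hL0 : 0 ≤ L)
    (hf1 : ∀ (k : Fin d) (x : Fin d → ℝ),
      DifferentiableAt ℝ (fun h : ℝ => f (Function.update x k h)) (x k))
    (hf2 : ∀ (k : Fin d) (x : Fin d → ℝ),
      DifferentiableAt ℝ (fun h : ℝ => pd k f (Function.update x k h)) (x k))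
    (hL : ∀ (k : Fin d) (x y : Fin d → ℝ),
      |pd k (pd k f) x - pd k (pd k f) y| ≤ L * dist x y ^ α) :
    HasBddPartials f (6 * M + 3 * L) (4 * M + 3 * L) := by
  intro k x
  have e1 : deriv (fun h : ℝ => f (Function.update x k h))
      = fun h => pd k f (Function.update x k h) := funext fun h => (pd_update k f x h).symm
  have e2 : deriv (fun h : ℝ => pd k f (Function.update x k h))
      = fun h => pd k (pd k f) (Function.update x k h) :=
    funext fun h => (pd_update k (pd k f) x h).symm
  have h := abs_le_of_holder_deriv_deriv (u := fun h : ℝ => f (Function.update x k h))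
    (fun _ => hM _) (fun h => by simpa using hf1 k (Function.update x k h))
    (by
      rw [e1]
      exact fun h => by simpa using hf2 k (Function.update x k h)) hα hα1 hL0
    (by
      rw [e1, e2]
      intro a b
      refine (hL k _ _).trans (mul_le_mul_of_nonneg_left ?_ hL0)
      refine Real.rpow_le_rpow dist_nonneg ?_ hα.le
      refine (dist_pi_le_iff (abs_nonneg _)).2 fun i => ?_
      by_cases hi : i = k
      · subst hi; simp [Real.dist_eq]
      · simp [hi]) (x k)
  rw [e1, e2] at h
  simp only [Function.update_eq_self] at h
  exact ⟨⟨hf1 k x, h.1⟩, hf2 k x, h.2⟩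

theorem continuous_of_holder {d : ℕ} {g : (Fin d → ℝ) → ℝ} {α L : ℝ} (hα : 0 < α)
    (hL : ∀ x y, |g x - g y| ≤ L * dist x y ^ α) : Continuous g := by
  refine continuous_iff_continuousAt.2 fun x => tendsto_iff_dist_tendsto_zero.2 ?_
  refine squeeze_zero (fun _ => dist_nonneg) (fun y => hL y x) ?_
  have hc : Continuous fun y => L * dist y x ^ α :=
    continuous_const.mul ((continuous_id.dist continuous_const).rpow_const fun _ => Or.inr hα.le)
  simpa [Real.zero_rpow hα.ne'] using hc.tendsto x

theorem integrableOn_btWeight_mul_heat {n d : ℕ} (j : Fin n) {t : Fin n → ℝ} (ht : ∀ i, 0 < t i)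
    {g : (Fin d → ℝ) → ℝ} (hg : Measurable g) {M : ℝ} (hM : ∀ z, |g z| ≤ M) (x : Fin d → ℝ) :
    IntegrableOn (fun s => btWeight j t s * heat (∏ i, s i) g x)
      {s : Fin n → ℝ | ∀ i, 0 < s i} := by
  have h0 := integrableOn_btWeight_mul_rpow j ht (a := 0) (by norm_num)
  simp only [Real.rpow_zero, mul_one] at h0
  refine (h0.mul_const (M * gaussianMoment d)).mono'
    ((measurable_btWeight j t).mul (measurable_heat_prod hg x)).aestronglyMeasurable
    (ae_of_all _ fun s => ?_)
  rw [Real.norm_eq_abs, abs_mul, abs_of_nonneg (btWeight_nonneg j ht s)]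
  exact mul_le_mul_of_nonneg_left (abs_heat_le hM x) (btWeight_nonneg j ht s)

theorem lap_integral_btWeight_heat {n d : ℕ} (j : Fin n) {t : Fin n → ℝ} (ht : ∀ i, 0 < t i)
    {f : (Fin d → ℝ) → ℝ} (hf : Measurable f) {M B₁ B₂ : ℝ} (hM : ∀ z, |f z| ≤ M)
    (hfb : HasBddPartials f B₁ B₂) :
    lap (fun x => ∫ s in {s : Fin n → ℝ | ∀ i, 0 < s i}, btWeight j t s * heat (∏ i, s i) f x)
      = fun x => ∫ s in {s : Fin n → ℝ | ∀ i, 0 < s i},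
          btWeight j t s * heat (∏ i, s i) (lap f) x := by
  funext x
  have h0 := integrableOn_btWeight_mul_rpow j ht (a := 0) (by norm_num)
  simp only [Real.rpow_zero, mul_one] at h0
  have h := (integral_lap (integrableOn_btWeight_mul_heat j ht hf hM)
    (h0.mul_const (B₁ * ∫ z : Fin d → ℝ, stdGaussian z))
    (h0.mul_const (B₂ * ∫ z : Fin d → ℝ, stdGaussian z))
    (ae_of_all _ fun s => by
      have := (heat_of_hasBddPartials (∏ i, s i) hf hM hfb).1.const_mul (btWeight j t s)
      rwa [abs_of_nonneg (btWeight_nonneg j ht s)] at this) x).2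
  refine h.trans (integral_congr_ae (ae_of_all _ fun s => ?_))
  simp only [lap_const_mul, (heat_of_hasBddPartials (∏ i, s i) hf hM hfb).2]

theorem lap_integral_btWeight_heat_of_holder {n d : ℕ} (j : Fin n) {t : Fin n → ℝ}
    (ht : ∀ i, 0 < t i) {g : (Fin d → ℝ) → ℝ} (hg : Measurable g) {M : ℝ}
    (hM : ∀ z, |g z| ≤ M) {α L : ℝ} (hα : 0 < α) (hα1 : α ≤ 1)
    (hL : ∀ x y, |g x - g y| ≤ L * dist x y ^ α) (hL0 : 0 ≤ L) (x : Fin d → ℝ) :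
    IntegrableOn (fun s => btWeight j t s * lap (heat (∏ i, s i) g) x)
      {s : Fin n → ℝ | ∀ i, 0 < s i} ∧
    lap (fun x => ∫ s in {s : Fin n → ℝ | ∀ i, 0 < s i}, btWeight j t s * heat (∏ i, s i) g x) x
      = ∫ s in {s : Fin n → ℝ | ∀ i, 0 < s i}, btWeight j t s * lap (heat (∏ i, s i) g) x := by
  have h1 := integrableOn_btWeight_mul_rpow j ht (a := -(1 / 2)) (by norm_num)
  have h2 := integrableOn_btWeight_mul_rpow j ht (a := α / 2 - 1) (by linarith)
  have h := integral_lap (integrableOn_btWeight_mul_heat j ht hg hM)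
    (h1.mul_const (M * gaussianMoment d)) (h2.mul_const (L * 2 * gaussianMoment d))
    (by
      filter_upwards [ae_restrict_mem (measurableSet_orthant n)] with s hs
      have hp : 0 < ∏ i, s i := Finset.prod_pos fun i _ => hs i
      have := (hasBddPartials_heat hp hg hM hα hα1 hL hL0).const_mul (btWeight j t s)
      rw [abs_of_nonneg (btWeight_nonneg j ht s), Real.sqrt_eq_rpow,
        ← Real.rpow_neg hp.le, ← mul_assoc (btWeight j t s) _ (M * _),
        ← mul_assoc (btWeight j t s) _ (L * 2 * _)] at this
      exact this) x
  simp only [lap_const_mul] at h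
  exact h

theorem abs_lap_heat_le {d : ℕ} {p : ℝ} (hp : 0 < p) {g : (Fin d → ℝ) → ℝ}
    (hg : Measurable g) {M : ℝ} (hM : ∀ z, |g z| ≤ M) {α L : ℝ} (hα : 0 < α) (hα1 : α ≤ 1)
    (hL : ∀ x y, |g x - g y| ≤ L * dist x y ^ α) (hL0 : 0 ≤ L) (x : Fin d → ℝ) :
    |lap (heat p g) x| ≤ p ^ (α / 2 - 1) * (d * (L * 2 * gaussianMoment d)) := by
  refine (Finset.abs_sum_le_sum_abs _ _).trans ((Finset.sum_le_sum fun k _ =>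
    abs_pd_pd_heat_le hp hg hM hα hα1 hL hL0 k x).trans (le_of_eq ?_))
  simp
  ring

theorem continuousOn_integral_btWeight_lap_heat {n d : ℕ} (j : Fin n) {g : (Fin d → ℝ) → ℝ}
    (hg : Continuous g) {M : ℝ} (hM : ∀ z, |g z| ≤ M) {α L : ℝ} (hα : 0 < α) (hα1 : α ≤ 1)
    (hL : ∀ x y, |g x - g y| ≤ L * dist x y ^ α) (hL0 : 0 ≤ L) :
    ContinuousOn (fun q : (Fin n → ℝ) × (Fin d → ℝ) =>
        ∫ s in {s : Fin n → ℝ | ∀ i, 0 < s i}, btWeight j q.1 s * lap (heat (∏ i, s i) g) q.2)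
      {q : (Fin n → ℝ) × (Fin d → ℝ) | ∀ i, 0 < q.1 i} := by
  rintro ⟨t₀, x₀⟩ ht0
  simp only [Set.mem_ofPred_eq] at ht0
  refine ContinuousAt.continuousWithinAt ?_
  have hnhds : ∀ᶠ q : (Fin n → ℝ) × (Fin d → ℝ) in nhds (t₀, x₀),
      ∀ i, t₀ i / 2 < q.1 i ∧ q.1 i < 2 * t₀ i := by
    refine eventually_all.2 fun i => ?_
    have hc : Continuous fun q : (Fin n → ℝ) × (Fin d → ℝ) => q.1 i := by fun_prop
    have h := ht0 i
    exact hc.continuousAt.eventually (Ioo_mem_nhds (by simp only; linarith)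
      (by simp only; linarith))
  have hdom := (integrableOn_btWeight_mul_rpow j (t := fun i => 2 * t₀ i)
    (fun i => mul_pos two_pos (ht0 i)) (a := α / 2 - 1) (by linarith)).const_mul
    (2 ^ n * (d * (L * 2 * gaussianMoment d)))
  refine continuousAt_of_dominated ?_ ?_ hdom ?_
  · filter_upwards [hnhds] with q hq
    exact (lap_integral_btWeight_heat_of_holder j (fun i => by linarith [(hq i).1, ht0 i])
      hg.measurable hM hα hα1 hL hL0 q.2).1.aestronglyMeasurable
  · filter_upwards [hnhds] with q hq
    filter_upwards [ae_restrict_mem (measurableSet_orthant n)] with s hs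
    have hp : 0 < ∏ i, s i := Finset.prod_pos fun i _ => hs i
    have hw := btWeight_nonneg j (t := q.1) (fun i => by linarith [(hq i).1, ht0 i]) s
    have hle := btWeight_le j ht0 (fun i => (hq i).1) (fun i => (hq i).2) s
    rw [Real.norm_eq_abs, abs_mul, abs_of_nonneg hw]
    calc _ ≤ 2 ^ n * btWeight j (fun i => 2 * t₀ i) s *
          ((∏ i, s i) ^ (α / 2 - 1) * (d * (L * 2 * gaussianMoment d))) :=
          mul_le_mul hle (abs_lap_heat_le hp hg.measurable hM hα hα1 hL hL0 q.2) (abs_nonneg _)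
            (hw.trans hle)
      _ = _ := by ring
  · filter_upwards [ae_restrict_mem (measurableSet_orthant n)] with s hs
    have hp : 0 < ∏ i, s i := Finset.prod_pos fun i _ => hs i
    refine ContinuousAt.mul ?_ ?_
    · exact ContinuousAt.comp (x := (t₀, x₀)) (g := fun t => btWeight j t s) (f := Prod.fst)
        (continuousAt_btWeight j ht0 s) continuousAt_fst
    · exact ((continuous_lap_heat hp hg hM).comp continuous_snd).continuousAt

/-- differentiation under the integral sign (BTBS case): the
bilaplacian of `ℰ^{(j)}(t,x) = ∫_{(0,∞)ⁿ} (∏_{i≠j} s_i²) E(s,x) ∏_i K^{BM}(t_i;0,s_i) ds`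
is finite and is obtained by putting `Δ_x²` under the integral; if moreover the
second partials of `f` are bounded, then `Δ_x² ℰ^{(j)}` is continuous. -/
theorem diff_under_integral_btbs
    (n d : ℕ) (hn : 1 ≤ n) (hd : 1 ≤ d) (j : Fin n)
    (f : (Fin d → ℝ) → ℝ) (hmeas : Measurable f) (M : ℝ) (hb : ∀ y, |f y| ≤ M)
    (α : ℝ) (hα1 : 0 < α) (hα2 : α ≤ 1)
    (hf1 : ∀ (l : Fin d) (x : Fin d → ℝ),
      DifferentiableAt ℝ (fun h : ℝ => f (Function.update x l h)) (x l))
    (hf2 : ∀ (k l : Fin d) (x : Fin d → ℝ),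
      DifferentiableAt ℝ (fun h : ℝ => pd l f (Function.update x k h)) (x k))
    (H : ℝ) (hH : ∀ (k l : Fin d) (x y : Fin d → ℝ),
      |pd k (pd l f) x - pd k (pd l f) y| ≤ H * dist x y ^ α)
    (E : (Fin n → ℝ) → (Fin d → ℝ) → ℝ)
    (hE : ∀ s x, E s x = ∫ y : Fin d → ℝ, f y * Kbs n d s x y)
    (Ecal : (Fin n → ℝ) → (Fin d → ℝ) → ℝ)
    (hEcal : ∀ t x, Ecal t x
      = ∫ s in {s : Fin n → ℝ | ∀ i, 0 < s i},
          (∏ i ∈ Finset.univ.erase j, s i ^ 2) * E s x * ∏ i, Kbm (t i) (s i)) :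
    (∀ (t : Fin n → ℝ) (x : Fin d → ℝ), (∀ i, 0 < t i) →
      MeasureTheory.IntegrableOn
        (fun s : Fin n → ℝ =>
          (∏ i ∈ Finset.univ.erase j, s i ^ 2) * lap (lap (E s)) x *
            ∏ i, Kbm (t i) (s i))
        {s : Fin n → ℝ | ∀ i, 0 < s i} ∧
      lap (lap (Ecal t)) x
        = ∫ s in {s : Fin n → ℝ | ∀ i, 0 < s i},
            (∏ i ∈ Finset.univ.erase j, s i ^ 2) * lap (lap (E s)) x *
              ∏ i, Kbm (t i) (s i)) ∧
    ((∃ M₂, ∀ (k l : Fin d) (x : Fin d → ℝ), |pd k (pd l f) x| ≤ M₂) →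
      ContinuousOn
        (fun p : (Fin n → ℝ) × (Fin d → ℝ) => lap (lap (Ecal p.1)) p.2)
        {p : (Fin n → ℝ) × (Fin d → ℝ) | ∀ i, 0 < p.1 i}) := by
  have hL0 : 0 ≤ |H| := abs_nonneg H
  have hH' : ∀ (k l : Fin d) (x y : Fin d → ℝ),
      |pd k (pd l f) x - pd k (pd l f) y| ≤ |H| * dist x y ^ α := fun k l x y =>
    (hH k l x y).trans (mul_le_mul_of_nonneg_right (le_abs_self H) (by positivity))
  have hfb := hasBddPartials_of_holder hb hα1 hα2 hL0 hf1 (fun k => hf2 k k)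
    (fun k => hH' k k)
  have hgL : ∀ x y, |lap f x - lap f y| ≤ d * |H| * dist x y ^ α := by
    intro x y
    rw [lap, lap, ← Finset.sum_sub_distrib]
    refine (Finset.abs_sum_le_sum_abs _ _).trans
      ((Finset.sum_le_sum fun k _ => hH' k k x y).trans (le_of_eq ?_))
    simp [mul_assoc]
  have hgM : ∀ x, |lap f x| ≤ d * (4 * M + 3 * |H|) := by
    intro x
    refine (Finset.abs_sum_le_sum_abs _ _).trans
      ((Finset.sum_le_sum fun k _ => (hfb k x).2.2).trans (le_of_eq ?_))
    simp [mul_add]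
  have hg : Continuous (lap f) := continuous_of_holder hα1 hgL
  have hgL0 : 0 ≤ d * |H| := by positivity
  have hEs : ∀ s : Fin n → ℝ, (∀ i, 0 < s i) → E s = heat (∏ i, s i) f := fun s hs => by
    funext x
    rw [hE, integral_mul_Kbs f s (Finset.prod_pos fun i _ => hs i) x]
  have hlE : ∀ s : Fin n → ℝ, (∀ i, 0 < s i) → lap (lap (E s)) = lap (heat (∏ i, s i) (lap f)) :=
    fun s hs => by rw [hEs s hs, (heat_of_hasBddPartials _ hmeas hb hfb).2]
  have hEc : ∀ t, Ecal t = fun x => ∫ s in {s : Fin n → ℝ | ∀ i, 0 < s i},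
      btWeight j t s * heat (∏ i, s i) f x := fun t => by
    funext x
    rw [hEcal]
    refine setIntegral_congr_fun (measurableSet_orthant n) fun s hs => ?_
    simp only [btWeight, hEs s hs]
    ring
  have hcg : ∀ (t : Fin n → ℝ) (x : Fin d → ℝ),
      Set.EqOn (fun s => btWeight j t s * lap (heat (∏ i, s i) (lap f)) x)
        (fun s : Fin n → ℝ => (∏ i ∈ Finset.univ.erase j, s i ^ 2) * lap (lap (E s)) x *
          ∏ i, Kbm (t i) (s i)) {s : Fin n → ℝ | ∀ i, 0 < s i} := fun t x s hs => by
    simp only [btWeight, hlE s hs]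
    ring
  have main : ∀ (t : Fin n → ℝ) (x : Fin d → ℝ), (∀ i, 0 < t i) →
      IntegrableOn (fun s => btWeight j t s * lap (heat (∏ i, s i) (lap f)) x)
        {s : Fin n → ℝ | ∀ i, 0 < s i} ∧
      lap (lap (Ecal t)) x = ∫ s in {s : Fin n → ℝ | ∀ i, 0 < s i},
        btWeight j t s * lap (heat (∏ i, s i) (lap f)) x := by
    intro t x ht
    rw [hEc t, lap_integral_btWeight_heat j ht hmeas hb hfb]
    exact lap_integral_btWeight_heat_of_holder j ht hg.measurable hgM hα1 hα2 hgL hgL0 x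
  refine ⟨fun t x ht => ⟨(main t x ht).1.congr_fun (hcg t x) (measurableSet_orthant n), ?_⟩,
    fun _ => ?_⟩
  · rw [(main t x ht).2]
    exact setIntegral_congr_fun (measurableSet_orthant n) (hcg t x)
  · exact (continuousOn_integral_btWeight_lap_heat j hg hgM hα1 hα2 hgL hgL0).congr
      fun q hq => (main q.1 q.2 hq).2
end
end
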